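/- arXiv:1501.06381 — 11 statements merged into one kernel-verified Lean document; each statement's English description precedes it below -/
import Mathlib

section
/- Let K be a compact Hausdorff space and let {(A_α, B_α) : α ∈ 𝒜} be a linked family of closed pairs of K. Then there exists a 1-equilateral set S ⊆ C(K) with |S| = |𝒜| such that every f ∈ S takes values in [0,1]. -/
/-- A family of pairs `(A i, B i)` of subsets of a set is *linked* if the members of each
pair are disjoint, each pair has nonempty union, and for distinct indices `i ≠ j` either
`A i` meets `B j` or `A j` meets `B i`. -/
def IsLinked {Γ ι : Type*} (A B : ι → Set Γ) : Prop :=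
  (∀ i, A i ∩ B i = ∅) ∧ (∀ i, (A i ∪ B i).Nonempty) ∧
    ∀ i j, i ≠ j → (A i ∩ B j).Nonempty ∨ (A j ∩ B i).Nonempty

/-- Two `[0,1]`-valued continuous functions on a compact space are at distance `1` as soon as
one of them vanishes at a point where the other equals `1`. -/
theorem ContinuousMap.dist_eq_one_of_eq_zero_of_eq_one {K : Type*} [TopologicalSpace K]
    [CompactSpace K] {f g : C(K, ℝ)} (hf : ∀ x, f x ∈ Set.Icc (0 : ℝ) 1)
    (hg : ∀ x, g x ∈ Set.Icc (0 : ℝ) 1) {x : K} (hfx : f x = 0) (hgx : g x = 1) :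
    dist f g = 1 := by
  apply le_antisymm
  · refine (ContinuousMap.dist_le zero_le_one).2 fun y => ?_
    simpa using Real.dist_le_of_mem_Icc (hf y) (hg y)
  · simpa [hfx, hgx] using ContinuousMap.dist_apply_le_dist (f := f) (g := g) x

/-- Lemma 2: for a compact Hausdorff space `K` and a linked family of closed pairs of `K`
indexed by `ι`, there is a `1`-equilateral set `S ⊆ C(K)` of `[0,1]`-valued functions with
`|S| = |ι|`. -/
theorem stmt1 {K : Type u} [TopologicalSpace K] [CompactSpace K] [T2Space K] {ι : Type u}
    (A B : ι → Set K) (hA : ∀ i, IsClosed (A i)) (hB : ∀ i, IsClosed (B i))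
    (h : IsLinked A B) :
    ∃ S : Set C(K, ℝ), Cardinal.mk S = Cardinal.mk ι ∧
      (∀ f ∈ S, ∀ x : K, f x ∈ Set.Icc (0 : ℝ) 1) ∧
      (∀ f ∈ S, ∀ g ∈ S, f ≠ g → dist f g = 1) := by
  obtain ⟨hdisj, -, hlink⟩ := h
  choose f hfA hfB hf using fun i =>
    exists_continuous_zero_one_of_isClosed (hA i) (hB i)
      (Set.disjoint_iff_inter_eq_empty.2 (hdisj i))
  have hdist : ∀ i j, i ≠ j → dist (f i) (f j) = 1 := by
    intro i j hij
    rcases hlink i j hij with ⟨x, hxA, hxB⟩ | ⟨x, hxA, hxB⟩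
    · exact ContinuousMap.dist_eq_one_of_eq_zero_of_eq_one (hf i) (hf j) (hfA i hxA) (hfB j hxB)
    · rw [dist_comm]
      exact ContinuousMap.dist_eq_one_of_eq_zero_of_eq_one (hf j) (hf i) (hfA j hxA) (hfB i hxB)
  have hinj : Function.Injective f := by
    intro i j hij
    by_contra hne
    simpa [hij] using hdist i j hne
  refine ⟨Set.range f, Cardinal.mk_range_eq f hinj, ?_, ?_⟩
  · rintro _ ⟨i, rfl⟩
    exact hf i
  · rintro _ ⟨i, rfl⟩ _ ⟨j, rfl⟩ hne
    exact hdist i j (ne_of_apply_ne f hne)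
end

section
/- Let K be a compact Hausdorff space and let α be an infinite cardinal. The following are equivalent: (1) the closed unit ball of C(K) contains a λ-equilateral set with λ > 1 of cardinality α; (2) the positive part of the unit sphere of C(K) (functions f with ‖f‖_∞ = 1 and f ≥ 0) contains a 1-equilateral set of cardinality α; (3) the closed unit ball of C(K) contains a (1+ε)-separated set, for some ε > 0, of cardinality α; (4) there exists a linked family of closed pairs of K of cardinality α. -/
/-- Urysohn functions separating the members of each pair in a linked family of closed pairs:
for distinct indices some point sends one function to `1` and the other to `0`. -/
theorem IsLinked.exists_continuousMap {K ι : Type*} [TopologicalSpace K] [CompactSpace K]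
    [T2Space K] {A B : ι → Set K} (hA : ∀ i, IsClosed (A i)) (hB : ∀ i, IsClosed (B i))
    (h : IsLinked A B) :
    ∃ g : ι → C(K, ℝ), (∀ i x, g i x ∈ Set.Icc (0 : ℝ) 1) ∧ (∀ i, ∀ x ∈ A i, g i x = 1) ∧
      ∀ i j, i ≠ j → ∃ x, |g i x - g j x| = 1 := by
  have hex : ∀ i, ∃ f : C(K, ℝ), Set.EqOn f 0 (B i) ∧ Set.EqOn f 1 (A i) ∧
      ∀ x, f x ∈ Set.Icc (0 : ℝ) 1 := fun i =>
    exists_continuous_zero_one_of_isClosed (hB i) (hA i)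
      (Set.disjoint_iff_inter_eq_empty.2 (h.1 i)).symm
  choose g hg0 hg1 hg using hex
  refine ⟨g, hg, fun i x hx => hg1 i hx, fun i j hij => ?_⟩
  rcases h.2.2 i j hij with ⟨x, hxA, hxB⟩ | ⟨x, hxA, hxB⟩
  · exact ⟨x, by simp [hg1 i hxA, hg0 j hxB]⟩
  · exact ⟨x, by simp [hg0 i hxB, hg1 j hxA]⟩

/-- In a linked family all pairs but at most one have nonempty first member. -/
theorem IsLinked.subsingleton_not_nonempty {Γ ι : Type*} {A B : ι → Set Γ} (h : IsLinked A B) :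
    {i | ¬ (A i).Nonempty}.Subsingleton := by
  intro i hi j hj
  by_contra hij
  rcases h.2.2 i j hij with h' | h'
  · exact hi h'.left
  · exact hj h'.left

/-- The distance of two continuous functions on a compact space, if positive, is attained. -/
theorem ContinuousMap.exists_le_dist_apply {K : Type*} [TopologicalSpace K] [CompactSpace K]
    {f g : C(K, ℝ)} {r : ℝ} (hr : 0 < r) (h : r ≤ dist f g) : ∃ x, r ≤ |f x - g x| := by
  by_contra! hlt
  exact absurd h (not_le.2 ((ContinuousMap.dist_lt_iff hr).2 hlt))

/-- The distance of two continuous functions is `r` if `r` bounds the pointwise distances and is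
attained. -/
theorem ContinuousMap.dist_eq_of_forall_le_of_exists {K : Type*} [TopologicalSpace K]
    [CompactSpace K] {f g : C(K, ℝ)} {r : ℝ} (hle : ∀ x, |f x - g x| ≤ r)
    (hex : ∃ x, |f x - g x| = r) : dist f g = r := by
  obtain ⟨x, hx⟩ := hex
  refine le_antisymm ((ContinuousMap.dist_le (hx ▸ abs_nonneg _)).2 hle) ?_
  rw [← hx]
  exact ContinuousMap.dist_apply_le_dist (f := f) (g := g) x

/-- An infinite set of continuous functions such that any two distinct members take, at some
point, values `≥ a` and `≤ b` with `b < a` yields a linked family of closed pairs. -/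
theorem exists_isLinked_of_forall_exists {K : Type u} [TopologicalSpace K] {S : Set C(K, ℝ)}
    {a b : ℝ} (hab : b < a) (hS : Cardinal.aleph0 ≤ Cardinal.mk S)
    (h : ∀ f ∈ S, ∀ g ∈ S, f ≠ g → ∃ x, (a ≤ f x ∧ g x ≤ b) ∨ (a ≤ g x ∧ f x ≤ b)) :
    ∃ (ι : Type u) (A B : ι → Set K), (∀ i, IsClosed (A i)) ∧ (∀ i, IsClosed (B i)) ∧
      IsLinked A B ∧ Cardinal.mk ι = Cardinal.mk S := by
  have : Infinite S := Cardinal.infinite_iff.2 hS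
  refine ⟨S, fun f => {x | a ≤ f.1 x}, fun f => {x | f.1 x ≤ b},
    fun f => isClosed_le continuous_const f.1.continuous,
    fun f => isClosed_le f.1.continuous continuous_const, ⟨fun f => ?_, fun f => ?_, ?_⟩, rfl⟩
  · ext x
    simp only [Set.mem_inter_iff, Set.mem_ofPred_eq, Set.mem_empty_iff_false, iff_false, not_and,
      not_le]
    exact fun hx => hab.trans_le hx
  · obtain ⟨g, hg⟩ := exists_ne f
    obtain ⟨x, hx | hx⟩ := h f f.2 g g.2 fun e => hg (Subtype.ext e.symm)
    · exact ⟨x, Or.inl hx.1⟩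
    · exact ⟨x, Or.inr hx.2⟩
  · intro f g hfg
    obtain ⟨x, hx | hx⟩ := h f f.2 g g.2 fun e => hfg (Subtype.ext e)
    · exact Or.inl ⟨x, hx⟩
    · exact Or.inr ⟨x, hx⟩


/-- Theorem 1: for a compact Hausdorff space `K` and an infinite cardinal `c`, the following
are equivalent: (1) the closed unit ball of `C(K)` contains a `λ`-equilateral set with `λ > 1`
of cardinality `c`; (2) the positive part of the unit sphere of `C(K)` contains a
`1`-equilateral set of cardinality `c`; (3) the closed unit ball of `C(K)` contains a
`(1+ε)`-separated set, for some `ε > 0`, of cardinality `c`; (4) `K` admits a linked family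
of closed pairs of cardinality `c`. -/
theorem stmt2 {K : Type u} [TopologicalSpace K] [CompactSpace K] [T2Space K]
    (c : Cardinal.{u}) (hc : Cardinal.aleph0 ≤ c) :
    List.TFAE
      [ ∃ (S : Set C(K, ℝ)) (l : ℝ), 1 < l ∧ S ⊆ Metric.closedBall 0 1 ∧
          (∀ f ∈ S, ∀ g ∈ S, f ≠ g → dist f g = l) ∧ Cardinal.mk S = c,
        ∃ S : Set C(K, ℝ), (∀ f ∈ S, ‖f‖ = 1 ∧ ∀ x : K, 0 ≤ f x) ∧
          (∀ f ∈ S, ∀ g ∈ S, f ≠ g → dist f g = 1) ∧ Cardinal.mk S = c,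
        ∃ (S : Set C(K, ℝ)) (ε : ℝ), 0 < ε ∧ S ⊆ Metric.closedBall 0 1 ∧
          (∀ f ∈ S, ∀ g ∈ S, f ≠ g → 1 + ε ≤ dist f g) ∧ Cardinal.mk S = c,
        ∃ (ι : Type u) (A B : ι → Set K), (∀ i, IsClosed (A i)) ∧ (∀ i, IsClosed (B i)) ∧
          IsLinked A B ∧ Cardinal.mk ι = c ] := by
  tfae_have 1 → 3 := by
    rintro ⟨S, l, hl, hS, hd, hcard⟩
    exact ⟨S, l - 1, by linarith, hS, fun f hf g hg hfg => by linarith [hd f hf g hg hfg], hcard⟩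
  tfae_have 3 → 4 := by
    rintro ⟨S, ε, hε, hS, hd, rfl⟩
    have hbound : ∀ f ∈ S, ∀ x, |f x| ≤ 1 := fun f hf x =>
      (f.norm_coe_le_norm x).trans (mem_closedBall_zero_iff.1 (hS hf))
    refine exists_isLinked_of_forall_exists (show -ε < ε by linarith) hc fun f hf g hg hfg => ?_
    obtain ⟨x, hx⟩ := ContinuousMap.exists_le_dist_apply (by linarith) (hd f hf g hg hfg)
    obtain ⟨hf₁, hf₂⟩ := abs_le.1 (hbound f hf x)
    obtain ⟨hg₁, hg₂⟩ := abs_le.1 (hbound g hg x)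
    refine ⟨x, ?_⟩
    rcases le_abs.1 hx with hx | hx
    · exact Or.inl ⟨by linarith, by linarith⟩
    · exact Or.inr ⟨by linarith, by linarith⟩
  tfae_have 2 → 4 := by
    rintro ⟨S, hS, hd, rfl⟩
    refine exists_isLinked_of_forall_exists zero_lt_one hc fun f hf g hg hfg => ?_
    obtain ⟨x, hx⟩ := ContinuousMap.exists_le_dist_apply one_pos (hd f hf g hg hfg).ge
    have hf₁ := (le_abs_self _).trans ((f.norm_coe_le_norm x).trans (hS f hf).1.le)
    have hg₁ := (le_abs_self _).trans ((g.norm_coe_le_norm x).trans (hS g hg).1.le)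
    have hf₀ := (hS f hf).2 x
    have hg₀ := (hS g hg).2 x
    refine ⟨x, ?_⟩
    rcases le_abs.1 hx with hx | hx
    · exact Or.inl ⟨by linarith, by linarith⟩
    · exact Or.inr ⟨by linarith, by linarith⟩
  tfae_have 4 → 1 := by
    rintro ⟨ι, A, B, hA, hB, hAB, rfl⟩
    obtain ⟨g, hg, -, hsep⟩ := hAB.exists_continuousMap hA hB
    let F : ι → C(K, ℝ) := fun i => ⟨fun x => 2 * g i x - 1, by fun_prop⟩
    have hF : ∀ i x, F i x = 2 * g i x - 1 := fun _ _ => rfl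
    have hdist : ∀ i j, i ≠ j → dist (F i) (F j) = 2 := by
      intro i j hij
      have hsub : ∀ x, |F i x - F j x| = 2 * |g i x - g j x| := fun x => by
        rw [hF, hF, ← abs_two, ← abs_mul, abs_two]
        ring_nf
      refine ContinuousMap.dist_eq_of_forall_le_of_exists (fun x => ?_) ?_
      · rw [hsub]
        have := abs_sub_le_of_le_of_le (hg i x).1 (hg i x).2 (hg j x).1 (hg j x).2
        linarith
      · obtain ⟨x, hx⟩ := hsep i j hij
        exact ⟨x, by rw [hsub, hx, mul_one]⟩
    have hinj : Function.Injective F := fun i j hij => by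
      by_contra hne
      have := hdist i j hne
      simp [hij] at this
    refine ⟨Set.range F, 2, one_lt_two, ?_, ?_, Cardinal.mk_range_eq F hinj⟩
    · rintro _ ⟨i, rfl⟩
      rw [mem_closedBall_zero_iff, ContinuousMap.norm_le _ zero_le_one]
      intro x
      rw [hF, Real.norm_eq_abs, abs_le]
      obtain ⟨h₀, h₁⟩ := hg i x
      constructor <;> linarith
    · rintro _ ⟨i, rfl⟩ _ ⟨j, rfl⟩ hne
      exact hdist i j fun e => hne (congrArg F e)
  tfae_have 4 → 2 := by
    rintro ⟨ι, A, B, hA, hB, hAB, rfl⟩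
    obtain ⟨g, hg, hg₁, hsep⟩ := hAB.exists_continuousMap hA hB
    have hdist : ∀ i j, i ≠ j → dist (g i) (g j) = 1 := fun i j hij =>
      ContinuousMap.dist_eq_of_forall_le_of_exists (fun x => by
        have := abs_sub_le_of_le_of_le (hg i x).1 (hg i x).2 (hg j x).1 (hg j x).2
        linarith) (hsep i j hij)
    have hinj : Function.Injective g := fun i j hij => by
      by_contra hne
      have := hdist i j hne
      simp [hij] at this
    have : Infinite ι := Cardinal.infinite_iff.2 hc
    have hcard : Cardinal.mk ({i | ¬ (A i).Nonempty}ᶜ : Set ι) = Cardinal.mk ι :=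
      Cardinal.mk_compl_of_infinite _
        ((Cardinal.lt_aleph0_iff_set_finite.2 hAB.subsingleton_not_nonempty.finite).trans_le hc)
    refine ⟨g '' {i | ¬ (A i).Nonempty}ᶜ, ?_, ?_, (Cardinal.mk_image_eq hinj).trans hcard⟩
    · rintro _ ⟨i, hi, rfl⟩
      obtain ⟨x, hx⟩ := not_not.1 hi
      refine ⟨le_antisymm ((ContinuousMap.norm_le _ zero_le_one).2 fun y => ?_) ?_,
        fun y => (hg i y).1⟩
      · rw [Real.norm_eq_abs, abs_of_nonneg (hg i y).1]
        exact (hg i y).2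
      · simpa [hg₁ i x hx] using (g i).norm_coe_le_norm x
    · rintro _ ⟨i, -, rfl⟩ _ ⟨j, -, rfl⟩ hne
      exact hdist i j fun e => hne (congrArg g e)
  tfae_finish
end

section
/- Let K be a compact Hausdorff space having a closed subset Ω that admits uncountably many relatively clopen subsets. Then K admits an uncountable linked family of closed pairs, and hence the closed unit ball of C(K) contains an uncountable 2-equilateral set. -/
/-- Disjoint closed subsets of a normal space are separated by a continuous function with values
in `[-1, 1]` that equals `1` on the first set and `-1` on the second. -/
theorem exists_continuous_one_neg_one_of_isClosed {X : Type*} [TopologicalSpace X]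
    [NormalSpace X] {A B : Set X} (hA : IsClosed A) (hB : IsClosed B) (hAB : A ∩ B = ∅) :
    ∃ f : C(X, ℝ), (∀ x ∈ A, f x = 1) ∧ (∀ x ∈ B, f x = -1) ∧ ∀ x, |f x| ≤ 1 := by
  obtain ⟨g, g0, g1, hg⟩ := exists_continuous_zero_one_of_isClosed hA hB
    (Set.disjoint_iff_inter_eq_empty.mpr hAB)
  refine ⟨1 - (g + g), fun x hx => ?_, fun x hx => ?_, fun x => ?_⟩
  · simp [g0 hx]
  · have := g1 hx
    simp only [Pi.one_apply] at this
    simp [this]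
  · obtain ⟨h0, h1⟩ := hg x
    simp only [ContinuousMap.sub_apply, ContinuousMap.one_apply, ContinuousMap.add_apply]
    rw [abs_le]
    constructor <;> linarith

/-- An uncountable linked family of closed pairs in a compact Hausdorff space `K` yields an
uncountable `2`-equilateral subset of the closed unit ball of `C(K)`. -/
theorem IsLinked.exists_uncountable_equilateral {K ι : Type*} [TopologicalSpace K]
    [CompactSpace K] [T2Space K] {A B : ι → Set K} (hA : ∀ i, IsClosed (A i))
    (hB : ∀ i, IsClosed (B i)) (hL : IsLinked A B) (hι : ¬ Countable ι) :
    ∃ S : Set C(K, ℝ), S ⊆ Metric.closedBall 0 1 ∧ ¬ S.Countable ∧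
      ∀ f ∈ S, ∀ g ∈ S, f ≠ g → dist f g = 2 := by
  choose f hfA hfB hf using fun i =>
    exists_continuous_one_neg_one_of_isClosed (hA i) (hB i) (hL.1 i)
  have key (i j : ι) (hij : (A i ∩ B j).Nonempty) : dist (f i) (f j) = 2 := by
    obtain ⟨x, hxA, hxB⟩ := hij
    refine le_antisymm ((ContinuousMap.dist_le zero_le_two).mpr fun y => ?_) ?_
    · have h₁ := abs_le.mp (hf i y)
      have h₂ := abs_le.mp (hf j y)
      rw [Real.dist_eq, abs_le]
      constructor <;> linarith
    · have := ContinuousMap.dist_apply_le_dist (f := f i) (g := f j) x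
      rw [hfA i x hxA, hfB j x hxB, Real.dist_eq] at this
      norm_num at this
      exact this
  have dist_eq (i j : ι) (hij : i ≠ j) : dist (f i) (f j) = 2 :=
    (hL.2.2 i j hij).elim (key i j) fun h => dist_comm (f i) (f j) ▸ key j i h
  have hinj : Function.Injective f := by
    intro i j hij
    by_contra hne
    have := dist_eq i j hne
    simp [hij] at this
  refine ⟨Set.range f, ?_, fun hc => hι ?_, ?_⟩
  · rintro _ ⟨i, rfl⟩
    rw [mem_closedBall_zero_iff, ContinuousMap.norm_le _ zero_le_one]
    exact hf i
  · have := hc.to_subtype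
    exact (Set.rangeFactorization_injective.mpr hinj).countable
  · rintro _ ⟨i, rfl⟩ _ ⟨j, rfl⟩ hij
    exact dist_eq i j fun h => hij (h ▸ rfl)

/-- The pairs formed by the relatively clopen subsets of a nonempty set `Ω` and their relative
complements are linked. -/
theorem isLinked_image_compl {Γ : Type*} {Ω : Set Γ} (hΩ : Ω.Nonempty) (𝒱 : Set (Set Ω)) :
    IsLinked (fun V : 𝒱 => Subtype.val '' V.1) (fun V : 𝒱 => Subtype.val '' V.1ᶜ) := by
  simp only [IsLinked, ← Set.image_inter Subtype.val_injective, ← Set.image_union,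
    Set.image_nonempty, Set.inter_compl_self, Set.union_compl_self, Set.image_empty,
    Set.inter_compl_nonempty_iff]
  refine ⟨fun _ => trivial, fun _ => ?_, fun V W hVW => ?_⟩
  · exact Set.nonempty_iff_univ_nonempty.mp hΩ.to_subtype
  · by_contra! h
    exact hVW (Subtype.ext (h.1.antisymm h.2))

/-- Theorem 2(1): if a compact Hausdorff space `K` has a closed subset `Ω` admitting
uncountably many relatively clopen subsets, then `K` admits an uncountable linked family of
closed pairs, and the closed unit ball of `C(K)` contains an uncountable `2`-equilateral
set. -/
theorem stmt3 {K : Type u} [TopologicalSpace K] [CompactSpace K] [T2Space K]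
    (Ω : Set K) (hΩ : IsClosed Ω)
    (h : ¬ {V : Set Ω | IsClopen V}.Countable) :
    (∃ (ι : Type u) (A B : ι → Set K), (∀ i, IsClosed (A i)) ∧ (∀ i, IsClosed (B i)) ∧
      IsLinked A B ∧ ¬ Countable ι) ∧
    ∃ S : Set C(K, ℝ), S ⊆ Metric.closedBall 0 1 ∧ ¬ S.Countable ∧
      ∀ f ∈ S, ∀ g ∈ S, f ≠ g → dist f g = 2 := by
  have hne : Ω.Nonempty := by
    by_contra hΩ'
    have : IsEmpty Ω := Set.isEmpty_coe_sort.mpr (Set.not_nonempty_iff_eq_empty.mp hΩ')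
    exact h (Set.to_countable _)
  have hA (V : {V : Set Ω | IsClopen V}) : IsClosed (Subtype.val '' V.1) :=
    hΩ.isClosedMap_subtype_val _ V.2.isClosed
  have hB (V : {V : Set Ω | IsClopen V}) : IsClosed (Subtype.val '' V.1ᶜ) :=
    hΩ.isClosedMap_subtype_val _ V.2.compl.isClosed
  have hL := isLinked_image_compl hne {V : Set Ω | IsClopen V}
  have hι : ¬ Countable {V : Set Ω | IsClopen V} := fun hc => h (Set.countable_coe_iff.mp hc)
  exact ⟨⟨_, _, _, hA, hB, hL, hι⟩, hL.exists_uncountable_equilateral hA hB hι⟩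
end

section
/- Let K be a compact Hausdorff space that is not hereditarily Lindelöf (i.e., some subspace of K is not Lindelöf). Then K admits an uncountable linked family of closed pairs, and hence the closed unit ball of C(K) contains an uncountable 2-equilateral set. -/
/-- There is a well-ordered type in every universe which is uncountable but has countable
initial segments. -/
theorem exists_uncountable_wellOrder_countable_Iio :
    ∃ (ι : Type u) (_ : LinearOrder ι), WellFoundedLT ι ∧ Uncountable ι ∧
      ∀ i : ι, (Set.Iio i).Countable := by
  refine ⟨(Cardinal.aleph 1).ord.ToType, inferInstance, inferInstance, ?_, fun i => ?_⟩
  · rw [← Cardinal.aleph0_lt_mk_iff, Cardinal.mk_ord_toType]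
    exact Cardinal.aleph0_lt_aleph_one
  · rw [← Cardinal.le_aleph0_iff_set_countable, ← Cardinal.lt_aleph_one_iff]
    have h := Cardinal.mk_Iio_lt i (by simp)
    rwa [Cardinal.mk_ord_toType] at h

/-- A non-Lindelöf set contains an uncountable right-separated family of points. -/
theorem exists_rightSeparated_of_not_isLindelof {X : Type u} [TopologicalSpace X] {Y : Set X}
    (hY : ¬ IsLindelof Y) :
    ∃ (ι : Type u) (_ : LinearOrder ι) (x : ι → X) (V : ι → Set X), Uncountable ι ∧
      (∀ i, IsOpen (V i)) ∧ (∀ i, x i ∈ V i) ∧ ∀ i j, i < j → x j ∉ V i := by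
  rw [isLindelof_iff_countable_subcover] at hY
  push Not at hY
  obtain ⟨κ, U, hU, hcov, hsub⟩ := hY
  have pick : ∀ t : Set κ, t.Countable →
      ∃ p : X × κ, p.1 ∈ U p.2 ∧ ∀ k ∈ t, p.1 ∉ U k := by
    intro t ht
    obtain ⟨y, hyY, hy⟩ := Set.not_subset.1 (hsub t ht)
    obtain ⟨k, hk⟩ := Set.mem_iUnion.1 (hcov hyY)
    exact ⟨(y, k), hk, fun l hl hyl => hy (Set.mem_biUnion hl hyl)⟩
  have : Nonempty (X × κ) := (pick ∅ Set.countable_empty).nonempty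
  choose! g hg using pick
  obtain ⟨ι, _, _, hunc, hcount⟩ := exists_uncountable_wellOrder_countable_Iio.{u}
  let F : ι → X × κ := (wellFounded_lt (α := ι)).fix fun i ih =>
    g (Set.range fun j : Set.Iio i => (ih j j.2).2)
  have hF : ∀ i, F i = g (Set.range fun j : Set.Iio i => (F j).2) := fun i =>
    WellFounded.fix_eq _ _ i
  have key : ∀ i, (F i).1 ∈ U (F i).2 ∧ ∀ j < i, (F i).1 ∉ U (F j).2 := by
    intro i
    have : Countable (Set.Iio i) := (hcount i).to_subtype
    have h := hg _ (Set.countable_range fun j : Set.Iio i => (F j).2)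
    rw [← hF i] at h
    exact ⟨h.1, fun j hj => h.2 _ ⟨⟨j, hj⟩, rfl⟩⟩
  exact ⟨ι, inferInstance, fun i => (F i).1, fun i => U (F i).2, hunc, fun i => hU _,
    fun i => (key i).1, fun i j hij => (key j).2 i hij⟩

/-- A linked family of closed pairs in a compact Hausdorff space `K` gives rise to a family of
functions in the unit ball of `C(K)` with all mutual distances equal to `2`. -/
theorem IsLinked.exists_dist_eq_two {K ι : Type*} [TopologicalSpace K] [CompactSpace K]
    [T2Space K] {A B : ι → Set K} (h : IsLinked A B) (hA : ∀ i, IsClosed (A i))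
    (hB : ∀ i, IsClosed (B i)) :
    ∃ f : ι → C(K, ℝ), (∀ i, f i ∈ Metric.closedBall 0 1) ∧
      ∀ i j, i ≠ j → dist (f i) (f j) = 2 := by
  have urysohn : ∀ i, ∃ f : C(K, ℝ), (∀ x ∈ A i, f x = -1) ∧ (∀ x ∈ B i, f x = 1) ∧
      ∀ x, f x ∈ Set.Icc (-1 : ℝ) 1 := by
    intro i
    obtain ⟨f, h1, h2, h3⟩ := exists_bounded_mem_Icc_of_closed_of_le (hA i) (hB i)
      (Set.disjoint_iff_inter_eq_empty.2 (h.1 i)) (by norm_num : (-1 : ℝ) ≤ 1)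
    exact ⟨f.toContinuousMap, fun x hx => h1 hx, fun x hx => h2 hx, h3⟩
  choose f hfA hfB hf using urysohn
  have hge : ∀ i j, (A i ∩ B j).Nonempty → 2 ≤ dist (f i) (f j) := by
    rintro i j ⟨x, hxA, hxB⟩
    refine le_trans ?_ (ContinuousMap.dist_apply_le_dist x)
    rw [hfA i x hxA, hfB j x hxB, Real.dist_eq]
    norm_num
  refine ⟨f, fun i => ?_, fun i j hij => le_antisymm ?_ ?_⟩
  · rw [Metric.mem_closedBall, ContinuousMap.dist_le zero_le_one]
    intro x
    simpa [Real.dist_eq] using abs_le.2 (hf i x)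
  · rw [ContinuousMap.dist_le zero_le_two]
    intro x
    rw [Real.dist_eq, abs_le]
    constructor <;> linarith [(hf i x).1, (hf i x).2, (hf j x).1, (hf j x).2]
  · rcases h.2.2 i j hij with hne | hne
    · exact hge i j hne
    · exact dist_comm (f i) (f j) ▸ hge j i hne

/-- Theorem 2(2): if a compact Hausdorff space `K` is not hereditarily Lindelöf (some
subspace of `K` is not Lindelöf), then `K` admits an uncountable linked family of closed
pairs, and the closed unit ball of `C(K)` contains an uncountable `2`-equilateral set. -/
theorem stmt4 {K : Type u} [TopologicalSpace K] [CompactSpace K] [T2Space K]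
    (h : ∃ Y : Set K, ¬ LindelofSpace Y) :
    (∃ (ι : Type u) (A B : ι → Set K), (∀ i, IsClosed (A i)) ∧ (∀ i, IsClosed (B i)) ∧
      IsLinked A B ∧ ¬ Countable ι) ∧
    ∃ S : Set C(K, ℝ), S ⊆ Metric.closedBall 0 1 ∧ ¬ S.Countable ∧
      ∀ f ∈ S, ∀ g ∈ S, f ≠ g → dist f g = 2 := by
  obtain ⟨Y, hY⟩ := h
  obtain ⟨ι, _, x, V, hunc, hV, hxV, hsep⟩ :=
    exists_rightSeparated_of_not_isLindelof (mt isLindelof_iff_lindelofSpace.1 hY)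
  have hA : ∀ i, IsClosed (V i)ᶜ := fun i => (hV i).isClosed_compl
  have hB : ∀ i, IsClosed ({x i} : Set K) := fun i => isClosed_singleton
  have hlink : IsLinked (fun i => (V i)ᶜ) fun i => ({x i} : Set K) := by
    refine ⟨fun i => ?_, fun i => ⟨x i, Or.inr rfl⟩, fun i j hij => ?_⟩
    · simpa using hxV i
    · rcases lt_or_gt_of_ne hij with hlt | hlt
      · exact Or.inl ⟨x j, hsep i j hlt, rfl⟩
      · exact Or.inr ⟨x i, hsep j i hlt, rfl⟩
  refine ⟨⟨ι, _, _, hA, hB, hlink, not_countable⟩, ?_⟩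
  obtain ⟨f, hball, hdist⟩ := hlink.exists_dist_eq_two hA hB
  have hinj : Function.Injective f := by
    intro i j hij
    by_contra hne
    have h2 := hdist i j hne
    rw [hij, dist_self] at h2
    norm_num at h2
  refine ⟨Set.range f, Set.range_subset_iff.2 hball, fun hc => ?_, ?_⟩
  · have := hc.to_subtype
    exact not_countable (Set.rangeFactorization_injective.2 hinj).countable
  · rintro _ ⟨i, rfl⟩ _ ⟨j, rfl⟩ hne
    exact hdist i j (ne_of_apply_ne f hne)
end

section
/- Let K be a compact Hausdorff space that is not metrizable. Then the compact space K × K is not hereditarily Lindelöf, and the closed unit ball of C(K × K) contains an uncountable 2-equilateral set. -/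
open TopologicalSpace in
/-- A compact Hausdorff space whose points are separated by countably many continuous real
functions is metrizable. -/
theorem metrizableSpace_of_countable_separating {K : Type*} [TopologicalSpace K] [CompactSpace K]
    [T2Space K] {S : Set C(K, ℝ)} (hS : S.Countable)
    (hsep : ∀ x y : K, x ≠ y → ∃ g ∈ S, g x ≠ g y) : MetrizableSpace K := by
  have : Countable S := hS.to_subtype
  let e : K → S → ℝ := fun x g => g.1 x
  have hcont : Continuous e := continuous_pi fun g => g.1.continuous
  have hinj : Function.Injective e := by
    intro x y hxy
    by_contra hne
    obtain ⟨g, hg, hgne⟩ := hsep x y hne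
    exact hgne (congrFun hxy ⟨g, hg⟩)
  have : SecondCountableTopology K :=
    (hcont.isClosedEmbedding hinj).isEmbedding.secondCountableTopology
  exact metrizableSpace_of_t3_secondCountable K

theorem exists_continuousMap_apply_ne {K : Type*} [TopologicalSpace K] [CompactSpace K]
    [T2Space K] {x y : K} (hxy : x ≠ y) : ∃ g : C(K, ℝ), g x ≠ g y := by
  obtain ⟨g, h0, h1, -⟩ := exists_continuous_zero_one_of_isClosed
    (isClosed_singleton (x := x)) (isClosed_singleton (x := y)) (by simpa using hxy)
  refine ⟨g, ?_⟩
  rw [h0 rfl, h1 rfl]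
  simp

/-- If the complement of the diagonal of a compact Hausdorff space is Lindelöf, then the space is
metrizable. -/
theorem metrizableSpace_of_lindelofSpace_offDiag {K : Type*} [TopologicalSpace K]
    [CompactSpace K] [T2Space K] (h : LindelofSpace {p : K × K | p.1 ≠ p.2}) :
    TopologicalSpace.MetrizableSpace K := by
  have hL : IsLindelof {p : K × K | p.1 ≠ p.2} := isLindelof_iff_lindelofSpace.mpr h
  obtain ⟨T, hT, hcov⟩ := hL.elim_countable_subcover
    (fun g : C(K, ℝ) => {p : K × K | g p.1 ≠ g p.2})
    (fun g => isOpen_ne_fun (by fun_prop) (by fun_prop))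
    (fun p hp => Set.mem_iUnion.mpr (exists_continuousMap_apply_ne hp))
  refine metrizableSpace_of_countable_separating hT fun x y hxy => ?_
  simpa using hcov (show (x, y) ∈ {p : K × K | p.1 ≠ p.2} from hxy)

/-- The functions which, for a fixed well-order of `C(K, ℝ)`, separate some pair of points that no
smaller function separates. -/
def minimalSeparating (K : Type*) [TopologicalSpace K] : Set C(K, ℝ) :=
  {g | ∃ x y : K, g x ≠ g y ∧ ∀ h : C(K, ℝ), WellOrderingRel h g → h x = h y}

theorem not_countable_minimalSeparating {K : Type*} [TopologicalSpace K] [CompactSpace K]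
    [T2Space K] (hK : ¬ TopologicalSpace.MetrizableSpace K) :
    ¬ (minimalSeparating K).Countable := by
  refine fun hS => hK (metrizableSpace_of_countable_separating hS fun x y hxy => ?_)
  have wf : WellFounded (WellOrderingRel (α := C(K, ℝ))) := IsWellFounded.wf
  obtain ⟨g, hg, hmin⟩ := wf.has_min {g : C(K, ℝ) | g x ≠ g y} (exists_continuousMap_apply_ne hxy)
  exact ⟨g, ⟨x, y, hg, fun h hh => by_contra fun hne => hmin h hne hh⟩, hg⟩

/-- A function on the square taking values in `[-1, 1]`, equal to `1` at a point `p` with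
`g p.1 ≠ g p.2` and to `-1` at all points `q` with `g q.1 = g q.2`. -/
noncomputable def separationBump {K : Type*} [TopologicalSpace K] (g : C(K, ℝ)) (p : K × K) :
    C(K × K, ℝ) where
  toFun q := 2 * min 1 (|g q.1 - g q.2| / |g p.1 - g p.2|) - 1

theorem separationBump_self {K : Type*} [TopologicalSpace K] {g : C(K, ℝ)} {p : K × K}
    (h : g p.1 ≠ g p.2) : separationBump g p p = 1 := by
  have : |g p.1 - g p.2| ≠ 0 := abs_ne_zero.mpr (sub_ne_zero.mpr h)
  simp only [separationBump, ContinuousMap.coe_mk, div_self this]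
  norm_num

theorem separationBump_of_eq {K : Type*} [TopologicalSpace K] {g : C(K, ℝ)} (p : K × K)
    {q : K × K} (h : g q.1 = g q.2) : separationBump g p q = -1 := by
  simp [separationBump, h]

theorem separationBump_mem_closedBall {K : Type*} [TopologicalSpace K] [CompactSpace K]
    (g : C(K, ℝ)) (p : K × K) :
    separationBump g p ∈ Metric.closedBall (0 : C(K × K, ℝ)) 1 := by
  rw [mem_closedBall_zero_iff, ContinuousMap.norm_le _ zero_le_one]
  intro q
  have h0 : 0 ≤ min 1 (|g q.1 - g q.2| / |g p.1 - g p.2|) := le_min zero_le_one (by positivity)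
  have h1 : min 1 (|g q.1 - g q.2| / |g p.1 - g p.2|) ≤ 1 := min_le_left _ _
  simp only [separationBump, ContinuousMap.coe_mk, Real.norm_eq_abs]
  exact abs_le.mpr ⟨by linarith, by linarith⟩

theorem dist_eq_two_of_mem_closedBall {X : Type*} [TopologicalSpace X] [CompactSpace X]
    {f g : C(X, ℝ)} (hf : f ∈ Metric.closedBall 0 1) (hg : g ∈ Metric.closedBall 0 1) {x : X}
    (hfx : f x = -1) (hgx : g x = 1) : dist f g = 2 := by
  apply le_antisymm
  · have := dist_triangle_right f g 0
    rw [Metric.mem_closedBall] at hf hg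
    linarith
  · have := ContinuousMap.dist_apply_le_dist (f := f) (g := g) x
    rw [hfx, hgx, Real.dist_eq] at this
    norm_num at this
    exact this

/-- Corollary 1 (case `Ω = K × K`): if `K` is a compact Hausdorff non-metrizable space, then
`K × K` is not hereditarily Lindelöf, and the closed unit ball of `C(K × K)` contains an
uncountable `2`-equilateral set. -/
theorem stmt8 {K : Type*} [TopologicalSpace K] [CompactSpace K] [T2Space K]
    (hK : ¬ TopologicalSpace.MetrizableSpace K) :
    (∃ Y : Set (K × K), ¬ LindelofSpace Y) ∧
    ∃ S : Set C(K × K, ℝ), S ⊆ Metric.closedBall 0 1 ∧ ¬ S.Countable ∧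
      ∀ f ∈ S, ∀ g ∈ S, f ≠ g → dist f g = 2 := by
  refine ⟨⟨_, fun h => hK (metrizableSpace_of_lindelofSpace_offDiag h)⟩, ?_⟩
  have hp : ∀ g : minimalSeparating K, ∃ p : K × K, g.1 p.1 ≠ g.1 p.2 ∧
      ∀ h : C(K, ℝ), WellOrderingRel h g.1 → h p.1 = h p.2 :=
    fun ⟨g, x, y, h⟩ => ⟨(x, y), h⟩
  choose p hne heq using hp
  let F : minimalSeparating K → C(K × K, ℝ) := fun g => separationBump g.1 (p g)
  have hball : ∀ g, F g ∈ Metric.closedBall 0 1 := fun g => separationBump_mem_closedBall _ _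
  have hlt : ∀ g h : minimalSeparating K, WellOrderingRel g.1 h.1 → dist (F g) (F h) = 2 :=
    fun g h hgh => dist_eq_two_of_mem_closedBall (hball g) (hball h)
      (separationBump_of_eq _ (heq h _ hgh)) (separationBump_self (hne h))
  have hdist : ∀ g h : minimalSeparating K, g ≠ h → dist (F g) (F h) = 2 := by
    intro g h hgh
    rcases trichotomous_of WellOrderingRel g.1 h.1 with hr | hr | hr
    · exact hlt g h hr
    · exact absurd (Subtype.ext hr) hgh
    · rw [dist_comm]
      exact hlt h g hr
  have hinj : Function.Injective F := by
    intro g h hgh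
    by_contra hne'
    have := hdist g h hne'
    rw [hgh, dist_self] at this
    norm_num at this
  refine ⟨Set.range F, Set.range_subset_iff.mpr hball, fun hc => ?_, ?_⟩
  · have : Countable (Set.range F) := hc.to_subtype
    have : Countable (minimalSeparating K) :=
      (Set.rangeFactorization_injective.mpr hinj).countable
    exact not_countable_minimalSeparating hK (Set.to_countable _)
  · rintro _ ⟨g, rfl⟩ _ ⟨h, rfl⟩ hgh
    exact hdist g h fun e => hgh (e ▸ rfl)
end

section
/- Let (X, ‖·‖) be a nonzero real normed space. Then m(X) = m(S_X ∪ {0}, 0), where S_X is the unit sphere of X and S_X ∪ {0} is regarded as a metric space with the norm metric; that is, the minimum cardinality of a maximal equilateral set in X equals the minimum cardinality of a maximal equilateral subset of the metric space S_X ∪ {0} that contains the point 0. -/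
/-- A subset `S` of a metric space is `l`-equilateral if any two distinct points of `S` are
at distance `l`. -/
def IsEquilateralWith {M : Type*} [MetricSpace M] (S : Set M) (l : ℝ) : Prop :=
  ∀ x ∈ S, ∀ y ∈ S, x ≠ y → dist x y = l

/-- A subset of a metric space is equilateral if it is `l`-equilateral for some `l > 0`. -/
def IsEquilateral {M : Type*} [MetricSpace M] (S : Set M) : Prop :=
  ∃ l : ℝ, 0 < l ∧ IsEquilateralWith S l

/-- An equilateral set is maximal if it is not a proper subset of an equilateral set. -/
def IsMaximalEquilateral {M : Type*} [MetricSpace M] (S : Set M) : Prop :=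
  IsEquilateral S ∧ ∀ T : Set M, IsEquilateral T → S ⊆ T → T = S

/-- `mNum M` is the minimum cardinality of a maximal equilateral set in `M`. -/
noncomputable def mNum (M : Type*) [MetricSpace M] : Cardinal :=
  sInf {c : Cardinal | ∃ S : Set M, IsMaximalEquilateral S ∧ Cardinal.mk S = c}

/-- `mNumAt M x` is the minimum cardinality of a maximal equilateral set in `M`
containing the point `x`. -/
noncomputable def mNumAt (M : Type*) [MetricSpace M] (x : M) : Cardinal :=
  sInf {c : Cardinal | ∃ S : Set M, IsMaximalEquilateral S ∧ x ∈ S ∧ Cardinal.mk S = c}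

theorem isEquilateral_image {M N : Type*} [MetricSpace M] [MetricSpace N] {g : M → N} {r : ℝ}
    (hr : 0 < r) (hg : ∀ x y, dist (g x) (g y) = r * dist x y) {S : Set M}
    (hS : IsEquilateral S) : IsEquilateral (g '' S) := by
  obtain ⟨l, hl, h⟩ := hS
  refine ⟨r * l, mul_pos hr hl, ?_⟩
  rintro _ ⟨x, hx, rfl⟩ _ ⟨y, hy, rfl⟩ hxy
  rw [hg, h x hx y hy (ne_of_apply_ne g hxy)]

theorem injective_of_dist_eq_mul {M N : Type*} [MetricSpace M] [MetricSpace N] {g : M → N} {r : ℝ}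
    (hr : 0 < r) (hg : ∀ x y, dist (g x) (g y) = r * dist x y) : Function.Injective g := by
  intro x y hxy
  have h := hg x y
  rw [hxy, dist_self] at h
  exact dist_eq_zero.1 ((mul_eq_zero.1 h.symm).resolve_left hr.ne')

/-- A set is maximal equilateral if its image under a similarity is. -/
theorem IsMaximalEquilateral.of_image {M N : Type*} [MetricSpace M] [MetricSpace N] {g : M → N}
    {r : ℝ} (hr : 0 < r) (hg : ∀ x y, dist (g x) (g y) = r * dist x y) {S : Set M}
    (hS : IsMaximalEquilateral (g '' S)) : IsMaximalEquilateral S := by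
  have hinj := injective_of_dist_eq_mul hr hg
  obtain ⟨⟨l, hl, h⟩, hmax⟩ := hS
  refine ⟨⟨l / r, div_pos hl hr, fun x hx y hy hxy => ?_⟩, fun T hT hST => ?_⟩
  · rw [eq_div_iff hr.ne', mul_comm, ← hg]
    exact h _ ⟨x, hx, rfl⟩ _ ⟨y, hy, rfl⟩ (hinj.ne hxy)
  · exact hinj.image_injective (hmax _ (isEquilateral_image hr hg hT) (Set.image_mono hST))

theorem IsMaximalEquilateral.nonempty {M : Type*} [MetricSpace M] [Nonempty M] {S : Set M}
    (hS : IsMaximalEquilateral S) : S.Nonempty := by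
  by_contra! h
  subst h
  obtain ⟨x⟩ := ‹Nonempty M›
  have hx : IsEquilateral ({x} : Set M) := by
    refine ⟨1, one_pos, ?_⟩
    rintro a rfl b rfl hab
    exact absurd rfl hab
  exact Set.singleton_ne_empty x (hS.2 _ hx (Set.empty_subset _))

theorem isEquilateral_pair {M : Type*} [MetricSpace M] {x y : M} (hxy : x ≠ y) :
    IsEquilateral ({x, y} : Set M) := by
  refine ⟨dist x y, dist_pos.2 hxy, ?_⟩
  rintro a (rfl | rfl) b (rfl | rfl) hab
  · exact absurd rfl hab
  · rfl
  · exact dist_comm _ _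
  · exact absurd rfl hab

theorem IsMaximalEquilateral.exists_ne {M : Type*} [MetricSpace M] [Nontrivial M] {S : Set M}
    (hS : IsMaximalEquilateral S) (x : M) : ∃ y ∈ S, y ≠ x := by
  by_contra! h
  obtain ⟨y, hy⟩ := _root_.exists_ne x
  have hpair := hS.2 _ (isEquilateral_pair hy) fun z hz => Or.inr (h z hz)
  exact hy (h y (hpair ▸ Set.mem_insert y {x}))

theorem nontrivial_zero_union_sphere {X : Type*} [NormedAddCommGroup X] [NormedSpace ℝ X]
    [Nontrivial X] : Nontrivial ({0} ∪ Metric.sphere (0 : X) 1 : Set X) := by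
  obtain ⟨u, hu⟩ := exists_norm_eq X zero_le_one
  refine ⟨⟨0, Or.inl rfl⟩, ⟨u, Or.inr (by simpa using hu)⟩, fun h => ?_⟩
  have h0 : (0 : X) = u := congrArg Subtype.val h
  rw [← h0, norm_zero] at hu
  exact zero_ne_one hu

/-- Rescaling a maximal equilateral set so that one of its points becomes the origin gives a
maximal equilateral set of the unit sphere together with the origin. -/
theorem IsMaximalEquilateral.exists_unit_sphere_card_eq {X : Type*} [NormedAddCommGroup X]
    [NormedSpace ℝ X] {S : Set X} (hS : IsMaximalEquilateral S) {x : X} (hx : x ∈ S) :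
    ∃ T : Set ({0} ∪ Metric.sphere (0 : X) 1 : Set X), IsMaximalEquilateral T ∧
      ⟨0, Or.inl rfl⟩ ∈ T ∧ Cardinal.mk T = Cardinal.mk S := by
  obtain ⟨l, hl, h⟩ := hS.1
  let g : ({0} ∪ Metric.sphere (0 : X) 1 : Set X) → X := fun y => x + l • (y : X)
  have hg : ∀ y z, dist (g y) (g z) = l * dist y z := fun y z => by
    simp only [g, dist_add_left, dist_smul₀, Real.norm_of_nonneg hl.le, Subtype.dist_eq]
  have hrange : S ⊆ Set.range g := by
    intro y hy
    refine ⟨⟨l⁻¹ • (y - x), ?_⟩, by simp [g, smul_inv_smul₀ hl.ne']⟩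
    by_cases hyx : y = x
    · exact Or.inl (by simp [hyx])
    · refine Or.inr ?_
      rw [mem_sphere_zero_iff_norm, norm_smul, ← dist_eq_norm, h y hy x hx hyx, norm_inv,
        Real.norm_of_nonneg hl.le, inv_mul_cancel₀ hl.ne']
  refine ⟨g ⁻¹' S, .of_image hl hg ?_, show x + l • (0 : X) ∈ S by rwa [smul_zero, add_zero],
    Cardinal.mk_preimage_of_injective_of_subset_range g S (injective_of_dist_eq_mul hl hg) hrange⟩
  rwa [Set.image_preimage_eq_of_subset hrange]

/-- A maximal equilateral set containing the origin in the unit sphere together with the origin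
is maximal equilateral in the whole space. -/
theorem IsMaximalEquilateral.image_val {X : Type*} [NormedAddCommGroup X] [NormedSpace ℝ X]
    [Nontrivial X] {S : Set ({0} ∪ Metric.sphere (0 : X) 1 : Set X)}
    (hS : IsMaximalEquilateral S) (h0 : ⟨0, Or.inl rfl⟩ ∈ S) :
    IsMaximalEquilateral (Subtype.val '' S) := by
  have := nontrivial_zero_union_sphere (X := X)
  have hval : ∀ x y : ({0} ∪ Metric.sphere (0 : X) 1 : Set X),
      dist (x : X) (y : X) = 1 * dist x y := fun x y => (one_mul _).symm
  refine ⟨isEquilateral_image one_pos hval hS.1, fun T hT hST => ?_⟩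
  obtain ⟨u, huS, hu0⟩ := hS.exists_ne ⟨0, Or.inl rfl⟩
  obtain ⟨l, hl, h⟩ := hT
  have hu0' : (u : X) ≠ 0 := fun hu => hu0 (Subtype.ext hu)
  have h0T : (0 : X) ∈ T := hST ⟨_, h0, rfl⟩
  have hl1 : l = 1 := by
    rw [← h u (hST ⟨u, huS, rfl⟩) 0 h0T hu0']
    exact u.2.resolve_left hu0'
  have hrange : T ⊆ Set.range
      (Subtype.val : ({0} ∪ Metric.sphere (0 : X) 1 : Set X) → X) := by
    intro y hy
    rw [Subtype.range_coe]
    by_cases hy0 : y = 0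
    · exact Or.inl hy0
    · exact Or.inr ((h y hy 0 h0T hy0).trans hl1)
  have himage := Set.image_preimage_eq_of_subset hrange
  have hpre : IsEquilateral ((Subtype.val : ({0} ∪ Metric.sphere (0 : X) 1 : Set X) → X) ⁻¹' T) :=
    ⟨l, hl, fun y hy z hz hyz => h y hy z hz (Subtype.val_injective.ne hyz)⟩
  rw [← himage, hS.2 _ hpre (Set.image_subset_iff.1 hST)]

/-- Lemma 3: for a nonzero real normed space `X`, the minimum cardinality of a maximal
equilateral set in `X` equals the minimum cardinality of a maximal equilateral subset of
the metric space `S_X ∪ {0}` containing the point `0`. -/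
theorem stmt10 {X : Type u} [NormedAddCommGroup X] [NormedSpace ℝ X] [Nontrivial X] :
    mNum X = mNumAt (({0} ∪ Metric.sphere (0 : X) 1 : Set X)) ⟨0, Or.inl rfl⟩ := by
  unfold mNum mNumAt
  congr 1
  ext c
  constructor
  · rintro ⟨S, hS, rfl⟩
    obtain ⟨x, hx⟩ := hS.nonempty
    exact hS.exists_unit_sphere_card_eq hx
  · rintro ⟨S, hS, h0, rfl⟩
    exact ⟨_, hS.image_val h0, Cardinal.mk_image_eq Subtype.val_injective⟩
end

section
/- Let X be an infinite locally compact Hausdorff space and let C₀(X) be the Banach space of continuous real-valued functions on X vanishing at infinity, with the supremum norm. Then m(C₀(X)) ≥ ℵ₀; equivalently, every finite equilateral subset of C₀(X) can be extended to a strictly larger equilateral set, so no maximal equilateral set in C₀(X) is finite. -/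
open scoped ZeroAtInfty

/-- The supremum distance between two functions vanishing at infinity is attained. -/
theorem ZeroAtInftyContinuousMap.exists_dist_eq {X : Type*} [TopologicalSpace X] [Nonempty X]
    (f g : C₀(X, ℝ)) : ∃ x, dist (f x) (g x) = dist f g := by
  have hle : ∀ x, dist (f x) (g x) ≤ dist f g := fun x => by
    rw [← ZeroAtInftyContinuousMap.dist_toBCF_eq_dist]
    exact BoundedContinuousFunction.dist_coe_le_dist (f := f.toBCF) (g := g.toBCF) x
  have hle' : ∀ C, 0 ≤ C → (∀ x, dist (f x) (g x) ≤ C) → dist f g ≤ C := fun C hC h => by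
    rw [← ZeroAtInftyContinuousMap.dist_toBCF_eq_dist]
    exact (BoundedContinuousFunction.dist_le hC).2 h
  by_cases h : ∃ x₀, f x₀ ≠ g x₀
  · obtain ⟨x₀, hx₀⟩ := h
    have hcont : Continuous fun x => dist (f x) (g x) := by fun_prop
    have hlim : Filter.Tendsto (fun x => dist (f x) (g x)) (Filter.cocompact X) (nhds 0) := by
      simpa using f.zero_at_infty'.dist g.zero_at_infty'
    obtain ⟨x, hx⟩ := hcont.exists_forall_ge' x₀
      ((hlim.eventually (gt_mem_nhds (dist_pos.2 hx₀))).mono fun _ => le_of_lt)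
    exact ⟨x, le_antisymm (hle x) (hle' _ dist_nonneg hx)⟩
  · push Not at h
    obtain ⟨x⟩ := ‹Nonempty X›
    exact ⟨x, le_antisymm (hle x) (hle' _ dist_nonneg fun y => by simp [h])⟩

/-- Any finite nonempty `l`-equilateral set in `C₀(X, ℝ)`, with `X` infinite, admits a function at
distance `l` from all its elements. -/
theorem IsEquilateralWith.exists_forall_dist_eq {X : Type*} [TopologicalSpace X]
    [LocallyCompactSpace X] [T2Space X] [Infinite X] {S : Set C₀(X, ℝ)} (hfin : S.Finite)
    (hne : S.Nonempty) {l : ℝ} (hl : 0 < l) (hS : IsEquilateralWith S l) :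
    ∃ g : C₀(X, ℝ), ∀ f ∈ S, dist g f = l := by
  classical
  lift S to Finset C₀(X, ℝ) using hfin
  have hne' : S.Nonempty := by simpa using hne
  have hptw : ∀ f ∈ S, ∀ g ∈ S, ∀ x, |f x - g x| ≤ l := by
    intro f hf g hg x
    by_cases hfg : f = g
    · simpa [hfg] using hl.le
    · rw [← hS f hf g hg hfg, ← ZeroAtInftyContinuousMap.dist_toBCF_eq_dist]
      exact BoundedContinuousFunction.dist_coe_le_dist (f := f.toBCF) (g := g.toBCF) x
  choose p hp using fun f g : C₀(X, ℝ) => ZeroAtInftyContinuousMap.exists_dist_eq f g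
  obtain ⟨y, hy⟩ := Infinite.exists_notMem_finset ((S ×ˢ S).image fun q => p q.1 q.2)
  obtain ⟨φ, hφ, hmax⟩ := S.exists_max_image (fun f => f y) hne'
  obtain ⟨b, hb1, hb0, hbc, hb⟩ := exists_continuous_one_zero_of_isCompact
    (isCompact_singleton (x := y)) (Finset.finite_toSet _).isClosed (Set.disjoint_singleton_left.2 hy)
  -- `M` is the pointwise maximum of the elements of `S`.
  let M : X → ℝ := fun x => S.sup' hne' fun f => f x
  have hMc : Continuous M := Continuous.finset_sup'_apply hne' fun f _ => f.continuous
  have hleM : ∀ f ∈ S, ∀ x, f x ≤ M x := fun f hf x => Finset.le_sup' (fun f => f x) hf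
  have hMle : ∀ f ∈ S, ∀ x, M x ≤ f x + l := fun f hf x =>
    Finset.sup'_le _ _ fun g hg => by linarith [(abs_le.1 (hptw g hg f hf x)).2]
  have hMy : M y = φ y := le_antisymm (Finset.sup'_le _ _ hmax) (hleM φ hφ y)
  let k : X → ℝ := fun x => max (M x - l - φ x) (-(l * b x))
  have hkc : Continuous k := by fun_prop
  have hk0 : ∀ x, b x = 0 → k x = 0 := fun x hx => by
    simpa [k, hx] using by linarith [hMle φ hφ x]
  have hkneg : ∀ x, k x ≤ 0 := fun x =>
    max_le (by linarith [hMle φ hφ x]) (neg_nonpos.2 (mul_nonneg hl.le (hb x).1))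
  have hky : k y = -l := by
    have : b y = 1 := hb1 rfl
    simp [k, this, hMy]
  have hks : HasCompactSupport k := hbc.mono fun x hx hx' => hx (hk0 x hx')
  let K : C₀(X, ℝ) := ⟨⟨k, hkc⟩, hks.is_zero_at_infty⟩
  refine ⟨φ + K, fun f hf => ?_⟩
  have hval : ∀ x, (φ + K) x = φ x + k x := fun x => rfl
  rw [← ZeroAtInftyContinuousMap.dist_toBCF_eq_dist]
  apply le_antisymm
  · refine (BoundedContinuousFunction.dist_le hl.le).2 fun x => ?_
    change |(φ + K) x - f x| ≤ l
    have h₁ : M x - l - φ x ≤ k x := le_max_left _ _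
    rw [hval, abs_le]
    constructor
    · linarith [hleM f hf x]
    · linarith [hkneg x, (abs_le.1 (hptw φ hφ f hf x)).2]
  · suffices ∃ x, l = |(φ + K) x - f x| by
      obtain ⟨x, hx⟩ := this
      rw [hx]
      exact BoundedContinuousFunction.dist_coe_le_dist (f := (φ + K).toBCF) (g := f.toBCF) x
    by_cases hfφ : φ = f
    · subst hfφ
      exact ⟨y, by rw [hval, hky]; simp [abs_of_pos hl]⟩
    · refine ⟨p φ f, ?_⟩
      have hmem := Finset.mem_coe.2 <| Finset.mem_image_of_mem (fun q => p q.1 q.2) <|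
        Finset.mk_mem_product hφ hf
      rw [hval, hk0 _ (hb0 hmem), add_zero, ← Real.dist_eq, hp, hS φ hφ f hf hfφ]

/-- Theorem 3: for an infinite locally compact Hausdorff space `X`, `m(C₀(X)) ≥ ℵ₀`:
every finite equilateral subset of `C₀(X)` extends to a strictly larger equilateral set,
so no maximal equilateral set in `C₀(X)` is finite. -/
theorem stmt11 {X : Type*} [TopologicalSpace X] [LocallyCompactSpace X] [T2Space X]
    [Infinite X] :
    (∀ S : Set C₀(X, ℝ), S.Finite → IsEquilateral S →
      ∃ T : Set C₀(X, ℝ), IsEquilateral T ∧ S ⊂ T) ∧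
    ∀ S : Set C₀(X, ℝ), IsMaximalEquilateral S → S.Infinite := by
  have key : ∀ S : Set C₀(X, ℝ), S.Finite → IsEquilateral S →
      ∃ T : Set C₀(X, ℝ), IsEquilateral T ∧ S ⊂ T := by
    rintro S hfin ⟨l, hl, hS⟩
    obtain rfl | hne := S.eq_empty_or_nonempty
    · exact ⟨{0}, ⟨1, one_pos, fun x hx y hy h => (h (hx.trans hy.symm)).elim⟩,
        Set.empty_ssubset.2 (Set.singleton_nonempty 0)⟩
    · obtain ⟨g, hg⟩ := hS.exists_forall_dist_eq hfin hne hl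
      have hgS : g ∉ S := fun h => hl.ne (by simpa using hg g h)
      refine ⟨insert g S, ⟨l, hl, ?_⟩, Set.ssubset_insert hgS⟩
      rintro x (rfl | hx) y (rfl | hy) hxy
      · exact (hxy rfl).elim
      · exact hg y hy
      · rw [dist_comm, hg x hx]
      · exact hS x hx y hy hxy
  refine ⟨key, fun S ⟨hS, hmax⟩ hfin => ?_⟩
  obtain ⟨T, hT, hST⟩ := key S hfin hS
  exact hST.ne (hmax T hT hST.subset).symm
end

section
/- Let {X_γ : γ ∈ Γ} be an infinite family of compact metrizable spaces each having at least two points, and let X = ∏_{γ∈Γ} X_γ with the product topology. Then m(C(X)) = |Γ|; that is, the minimum cardinality of a maximal equilateral set in C(X) equals the cardinality of Γ. -/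
theorem ContinuousMap.exists_finset_forall_dist_lt {Γ : Type*} {X : Γ → Type*}
    [∀ γ, TopologicalSpace (X γ)] [∀ γ, CompactSpace (X γ)]
    [∀ γ, TopologicalSpace.MetrizableSpace (X γ)] (f : C((γ : Γ) → X γ, ℝ)) {ε : ℝ}
    (hε : 0 < ε) :
    ∃ F : Finset Γ, ∀ x y : (γ : Γ) → X γ, (∀ γ ∈ F, x γ = y γ) → dist (f x) (f y) < ε := by
  let _ : ∀ γ, MetricSpace (X γ) := fun γ => TopologicalSpace.metrizableSpaceMetric (X γ)
  have hf : UniformContinuous f := CompactSpace.uniformContinuous_of_continuous f.continuous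
  have h := hf (Metric.dist_mem_uniformity hε)
  rw [Filter.mem_map, Pi.uniformity, Filter.mem_iInf] at h
  obtain ⟨I, hI, V, hV, hs⟩ := h
  refine ⟨hI.toFinset, fun x y hxy => ?_⟩
  have hmem : (x, y) ∈ ⋂ i, V i := by
    refine Set.mem_iInter.2 fun i => ?_
    obtain ⟨t, ht, hsub⟩ := hV i
    refine hsub ?_
    have hi : x i = y i := hxy i (by simp)
    simpa only [Set.mem_preimage, hi] using refl_mem_uniformity ht
  rw [← hs] at hmem
  exact hmem

theorem ContinuousMap.exists_countable_forall_eq {Γ : Type*} {X : Γ → Type*}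
    [∀ γ, TopologicalSpace (X γ)] [∀ γ, CompactSpace (X γ)]
    [∀ γ, TopologicalSpace.MetrizableSpace (X γ)] (f : C((γ : Γ) → X γ, ℝ)) :
    ∃ A : Set Γ, A.Countable ∧
      ∀ x y : (γ : Γ) → X γ, (∀ γ ∈ A, x γ = y γ) → f x = f y := by
  choose F hF using fun n : ℕ =>
    f.exists_finset_forall_dist_lt (ε := 1 / ((n : ℝ) + 1)) Nat.one_div_pos_of_nat
  refine ⟨⋃ n, (F n : Set Γ), Set.countable_iUnion fun n => (F n).countable_toSet,
    fun x y hxy => ?_⟩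
  refine eq_of_forall_dist_le fun ε hε => ?_
  obtain ⟨n, hn⟩ := exists_nat_one_div_lt hε
  exact ((hF n x y fun γ hγ => hxy γ (Set.mem_iUnion.2 ⟨n, hγ⟩)).trans hn).le

/-- The continuous functions on a product of compact metrizable spaces have a dense family
indexed by pairs of a finite set of coordinates and a natural number. -/
theorem ContinuousMap.exists_finset_prod_nat_dist_lt {Γ : Type*} (X : Γ → Type*)
    [∀ γ, TopologicalSpace (X γ)] [∀ γ, CompactSpace (X γ)]
    [∀ γ, TopologicalSpace.MetrizableSpace (X γ)] [∀ γ, Nonempty (X γ)] :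
    ∃ u : Finset Γ × ℕ → C((γ : Γ) → X γ, ℝ), ∀ f, ∀ ε > 0, ∃ p, dist f (u p) < ε := by
  classical
  let _ : ∀ γ, MetricSpace (X γ) := fun γ => TopologicalSpace.metrizableSpaceMetric (X γ)
  let π : (F : Finset Γ) → C((γ : Γ) → X γ, (γ : F) → X γ) := fun F =>
    ⟨fun x γ => x γ, by fun_prop⟩
  let r : (F : Finset Γ) → C((γ : F) → X γ, (γ : Γ) → X γ) := fun F =>
    ⟨fun z γ => if h : γ ∈ F then z ⟨γ, h⟩ else Classical.arbitrary _, by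
      refine continuous_pi fun γ => ?_
      by_cases h : γ ∈ F
      · simpa [h] using continuous_apply (⟨γ, h⟩ : F)
      · simpa [h] using continuous_const⟩
  refine ⟨fun p => (TopologicalSpace.denseSeq C((γ : p.1) → X γ, ℝ) p.2).comp (π p.1),
    fun f ε hε => ?_⟩
  obtain ⟨F, hF⟩ := f.exists_finset_forall_dist_lt (half_pos hε)
  obtain ⟨n, hn⟩ := (TopologicalSpace.denseRange_denseSeq C((γ : F) → X γ, ℝ)).exists_dist_lt
    (f.comp (r F)) (half_pos hε)
  refine ⟨(F, n), (ContinuousMap.dist_lt_iff hε).2 fun x => ?_⟩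
  have h₁ : dist (f x) (f (r F (π F x))) < ε / 2 :=
    hF _ _ fun γ hγ => by simp [r, π, hγ]
  have h₂ := (ContinuousMap.dist_apply_le_dist (f := f.comp (r F)) (π F x)).trans_lt hn
  exact (dist_triangle _ _ _).trans_lt ((add_lt_add h₁ h₂).trans_eq (add_halves ε))

theorem IsEquilateral.mk_le {Γ : Type u} [Infinite Γ] (X : Γ → Type u)
    [∀ γ, TopologicalSpace (X γ)] [∀ γ, CompactSpace (X γ)]
    [∀ γ, TopologicalSpace.MetrizableSpace (X γ)] [∀ γ, Nonempty (X γ)]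
    {S : Set C((γ : Γ) → X γ, ℝ)} (hS : IsEquilateral S) : Cardinal.mk S ≤ Cardinal.mk Γ := by
  obtain ⟨l, hl, hS⟩ := hS
  obtain ⟨u, hu⟩ := ContinuousMap.exists_finset_prod_nat_dist_lt X
  choose p hp using fun f : S => hu f (l / 2) (half_pos hl)
  have hinj : Function.Injective fun f : S => (ULift.up (p f) : ULift.{u} (Finset Γ × ℕ)) := by
    intro f g hfg
    by_contra hne
    have hpfg : p f = p g := by simpa using hfg
    have h₁ := hS f f.2 g g.2 (fun h => hne (Subtype.ext h))
    have h₂ := hp f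
    have h₃ := hp g
    rw [hpfg] at h₂
    have h₄ := dist_triangle_right (f : C((γ : Γ) → X γ, ℝ)) g (u (p g))
    linarith
  refine (Cardinal.mk_le_of_injective hinj).trans ?_
  simp

/-- Every `l`-equilateral set with two points extends to a maximal equilateral set. -/
theorem IsEquilateralWith.exists_isMaximalEquilateral {M : Type*} [MetricSpace M] {S : Set M}
    {l : ℝ} (hS : IsEquilateralWith S l) (hnt : S.Nontrivial) :
    ∃ T, S ⊆ T ∧ IsMaximalEquilateral T := by
  obtain ⟨a, ha, b, hb, hab⟩ := hnt
  have hl : 0 < l := hS a ha b hb hab ▸ dist_pos.2 hab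
  obtain ⟨T, hST, hT⟩ := zorn_subset_nonempty {T : Set M | IsEquilateralWith T l}
    (fun c hc hchain _ => ⟨⋃₀ c, by
      rintro x ⟨s, hs, hx⟩ y ⟨t, ht, hy⟩ hxy
      rcases hchain.total hs ht with h | h
      · exact hc ht x (h hx) y hy hxy
      · exact hc hs x hx y (h hy) hxy, fun s hs => Set.subset_sUnion_of_mem hs⟩) S hS
  refine ⟨T, hST, ⟨l, hl, hT.prop⟩, ?_⟩
  rintro U ⟨k, -, hU⟩ hTU
  have hkl : k = l := (hU a (hTU (hST ha)) b (hTU (hST hb)) hab).symm.trans (hS a ha b hb hab)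
  exact (hT.eq_of_subset (hkl ▸ hU) hTU).symm

theorem IsMaximalEquilateral.exists_dist_ne {M : Type*} [MetricSpace M] {S : Set M}
    (hS : IsMaximalEquilateral S) {l : ℝ} (hl : 0 < l) (hSl : IsEquilateralWith S l) (g : M) :
    ∃ f ∈ S, dist f g ≠ l := by
  by_contra! h
  have hg : g ∉ S := fun hg => hl.ne' (by rw [← h g hg, dist_self])
  refine hg (hS.2 (insert g S) ⟨l, hl, ?_⟩ (Set.subset_insert g S) ▸ Set.mem_insert g S)
  rintro x (rfl | hx) y (rfl | hy) hxy
  · exact absurd rfl hxy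
  · rw [dist_comm]; exact h y hy
  · exact h x hx
  · exact hSl x hx y hy hxy

theorem ContinuousMap.exists_dist_apply_eq_dist {K : Type*} [TopologicalSpace K] [CompactSpace K]
    [Nonempty K] (f g : C(K, ℝ)) : ∃ x, dist (f x) (g x) = dist f g := by
  obtain ⟨x, -, hx⟩ := isCompact_univ.exists_isMaxOn Set.univ_nonempty
    (f.continuous.dist g.continuous).continuousOn
  exact ⟨x, le_antisymm (ContinuousMap.dist_apply_le_dist x)
    ((ContinuousMap.dist_le dist_nonneg).2 fun y => hx (Set.mem_univ y))⟩

/-- An equilateral set in `C(K)` with `K` infinite compact is never both finite and maximal. -/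
theorem IsMaximalEquilateral.infinite {K : Type*} [TopologicalSpace K] [CompactSpace K]
    [T2Space K] [Infinite K] {S : Set C(K, ℝ)} (hS : IsMaximalEquilateral S) : S.Infinite := by
  classical
  intro hfin
  obtain ⟨l, hl, hSl⟩ := hS.1
  have hne : hfin.toFinset.Nonempty := by
    obtain ⟨f, hf, -⟩ := hS.exists_dist_ne hl hSl 0
    exact ⟨f, by simpa using hf⟩
  let m : C(K, ℝ) := hfin.toFinset.sup' hne id
  have hm : ∀ f ∈ S, ∀ x, f x ≤ m x := fun f hf x =>
    (Finset.le_sup' id (hfin.mem_toFinset.2 hf) : f ≤ m) x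
  have hatt : ∀ x, ∃ f : hfin.toFinset, m x = f.1 x := fun x => by
    obtain ⟨f, hf, h⟩ := hfin.toFinset.exists_mem_eq_sup' hne fun f : C(K, ℝ) => f x
    exact ⟨⟨f, hf⟩, by simpa [m, ContinuousMap.sup'_apply] using h⟩
  choose w hw using hatt
  obtain ⟨⟨f, hf⟩, hinf⟩ := Finite.exists_infinite_fiber w
  rw [hfin.mem_toFinset] at hf
  choose q hq using fun g : C(K, ℝ) => f.exists_dist_apply_eq_dist g
  have hP : (q '' S).Finite := hfin.image q
  obtain ⟨y, hy, hyP⟩ := (Set.infinite_coe_iff.1 hinf).exists_notMem_finite hP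
  have hmy : m y = f y := by
    have : w y = ⟨f, _⟩ := hy
    rw [hw y, this]
  obtain ⟨φ, hφ0, hφ1, hφ⟩ := exists_continuous_zero_one_of_isClosed hP.isClosed
    (isClosed_singleton (x := y)) (Set.disjoint_singleton_right.2 hyP)
  let g : C(K, ℝ) := (f - l • φ) ⊔ (m - ContinuousMap.const K l)
  have hg : ∀ x, g x = max (f x - l * φ x) (m x - l) := fun x => rfl
  have hd : ∀ h ∈ S, ∀ k ∈ S, ∀ x, |h x - k x| ≤ l := fun h hh k hk x => by
    have h₁ : dist (h x) (k x) ≤ dist h k := ContinuousMap.dist_apply_le_dist x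
    rw [Real.dist_eq] at h₁
    by_cases hhk : h = k
    · simpa [hhk] using hl.le
    · rwa [hSl h hh k hk hhk] at h₁
  have hml : ∀ h ∈ S, ∀ x, m x - l ≤ h x := fun h hh x => by
    have := hd (w x).1 (hfin.mem_toFinset.1 (w x).2) h hh x
    rw [hw x]
    linarith [(abs_le.1 this).2]
  obtain ⟨h, hh, hne'⟩ := hS.exists_dist_ne hl hSl g
  refine hne' (le_antisymm ((ContinuousMap.dist_le hl.le).2 fun x => ?_) ?_)
  · rw [Real.dist_eq, abs_le, hg]
    have h₁ : f x - l * φ x ≤ f x := by nlinarith [(hφ x).1]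
    have h₂ := max_le h₁ (hml f hf x)
    have h₃ := (abs_le.1 (hd h hh f hf x)).1
    have h₄ := le_max_right (f x - l * φ x) (m x - l)
    have h₅ := hm h hh x
    constructor <;> linarith
  · by_cases hhf : h = f
    · have hgy : g y = f y - l := by
        rw [hg, hmy, hφ1 rfl]; simp
      have := ContinuousMap.dist_apply_le_dist (f := h) (g := g) y
      rw [hhf, hgy, Real.dist_eq] at this
      rw [hhf]
      simpa [abs_of_pos hl] using this
    · have hgq : g (q h) = f (q h) := by
        rw [hg, hφ0 ⟨h, hh, rfl⟩]
        simpa using hml f hf (q h)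
      have := ContinuousMap.dist_apply_le_dist (f := h) (g := g) (q h)
      rwa [hgq, dist_comm, hq h, hSl f hf h hh (Ne.symm hhf)] at this

/-- An equilateral set of functions not depending on one coordinate is not maximal. -/
theorem IsMaximalEquilateral.exists_apply_ne {Γ : Type*} {X : Γ → Type*}
    [∀ γ, TopologicalSpace (X γ)] [∀ γ, CompactSpace (X γ)]
    [∀ γ, T2Space (X γ)] [∀ γ, Nontrivial (X γ)]
    {S : Set C((γ : Γ) → X γ, ℝ)} (hS : IsMaximalEquilateral S) (hnt : S.Nontrivial) (δ : Γ) :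
    ∃ f ∈ S, ∃ x y : (γ : Γ) → X γ, (∀ γ, γ ≠ δ → x γ = y γ) ∧ f x ≠ f y := by
  classical
  by_contra! hind
  obtain ⟨l, hl, hSl⟩ := hS.1
  obtain ⟨f₀, hf₀, f₁, hf₁, hf⟩ := hnt
  obtain ⟨a, b, hab⟩ := exists_pair_ne (X δ)
  obtain ⟨φ, hφ0, hφ1, hφ⟩ := exists_continuous_zero_one_of_isClosed (isClosed_singleton (x := a))
    (isClosed_singleton (x := b)) (by simpa using hab)
  let ψ : C((γ : Γ) → X γ, ℝ) := φ.comp ⟨fun x => x δ, continuous_apply δ⟩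
  let g : C((γ : Γ) → X γ, ℝ) := f₀ + ψ * (f₁ - f₀)
  have hg : ∀ x, g x = f₀ x + φ (x δ) * (f₁ x - f₀ x) := fun x => rfl
  have hupd : ∀ f ∈ S, ∀ x c, f (Function.update x δ c) = f x := fun f hf x c =>
    hind f hf _ _ fun γ hγ => Function.update_of_ne hγ _ _
  have hd : ∀ h ∈ S, ∀ k ∈ S, ∀ x, |h x - k x| ≤ l := fun h hh k hk x => by
    have h₁ : dist (h x) (k x) ≤ dist h k := ContinuousMap.dist_apply_le_dist x
    rw [Real.dist_eq] at h₁
    by_cases hhk : h = k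
    · simpa [hhk] using hl.le
    · rwa [hSl h hh k hk hhk] at h₁
  have key : ∀ h ∈ S, ∀ k ∈ S, h ≠ k → ∀ c, (∀ x, g (Function.update x δ c) = k x) →
      l ≤ dist h g := by
    intro h hh k hk hhk c hc
    obtain ⟨x, hx⟩ := h.exists_dist_apply_eq_dist k
    have := ContinuousMap.dist_apply_le_dist (f := h) (g := g) (Function.update x δ c)
    rwa [hc, hupd h hh, hx, hSl h hh k hk hhk] at this
  obtain ⟨h, hh, hne'⟩ := hS.exists_dist_ne hl hSl g
  refine hne' (le_antisymm ((ContinuousMap.dist_le hl.le).2 fun x => ?_) ?_)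
  · have h₀ := abs_le.1 (hd h hh f₀ hf₀ x)
    have h₁ := abs_le.1 (hd h hh f₁ hf₁ x)
    obtain ⟨hp, hp'⟩ := hφ (x δ)
    rw [Real.dist_eq, abs_le, hg]
    constructor <;> nlinarith
  · by_cases hhf : h = f₀
    · refine key h hh f₁ hf₁ (hhf ▸ hf) b fun x => ?_
      rw [hg, hupd f₀ hf₀, hupd f₁ hf₁, Function.update_self, hφ1 rfl]
      simp
    · refine key h hh f₀ hf₀ hhf a fun x => ?_
      rw [hg, hupd f₀ hf₀, Function.update_self, hφ0 rfl]
      simp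

theorem IsMaximalEquilateral.le_mk {Γ : Type u} [Infinite Γ] (X : Γ → Type u)
    [∀ γ, TopologicalSpace (X γ)] [∀ γ, CompactSpace (X γ)]
    [∀ γ, TopologicalSpace.MetrizableSpace (X γ)] [∀ γ, Nontrivial (X γ)]
    {S : Set C((γ : Γ) → X γ, ℝ)} (hS : IsMaximalEquilateral S) :
    Cardinal.mk Γ ≤ Cardinal.mk S := by
  have hinf : S.Infinite := hS.infinite
  have : Infinite S := hinf.to_subtype
  choose A hA hfA using fun f : S => f.1.exists_countable_forall_eq
  have hcover : (⋃ f, A f) = Set.univ := by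
    refine Set.eq_univ_of_forall fun δ => ?_
    obtain ⟨f, hf, x, y, hxy, hne⟩ := hS.exists_apply_ne hinf.nontrivial δ
    by_contra hδ
    refine hne (hfA ⟨f, hf⟩ x y fun γ hγ => hxy γ ?_)
    rintro rfl
    exact hδ (Set.mem_iUnion.2 ⟨_, hγ⟩)
  calc Cardinal.mk Γ = Cardinal.mk (⋃ f, A f) := by rw [hcover, Cardinal.mk_univ]
    _ ≤ Cardinal.sum fun f => Cardinal.mk (A f) := Cardinal.mk_iUnion_le_sum_mk
    _ ≤ Cardinal.sum fun _ : S => Cardinal.aleph0 :=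
      Cardinal.sum_le_sum _ _ fun f => (hA f).le_aleph0
    _ = Cardinal.mk S := by simp

/-- Theorem 4: if `{X γ : γ ∈ Γ}` is an infinite family of compact metrizable spaces, each
with at least two points, and `X = ∏ γ, X γ`, then the minimum cardinality of a maximal
equilateral set in `C(X)` equals the cardinality of `Γ`. -/
theorem stmt13 {Γ : Type u} [Infinite Γ] (X : Γ → Type u)
    [∀ γ, TopologicalSpace (X γ)] [∀ γ, CompactSpace (X γ)]
    [∀ γ, TopologicalSpace.MetrizableSpace (X γ)] [∀ γ, Nontrivial (X γ)] :
    mNum (ContinuousMap ((γ : Γ) → X γ) ℝ) = Cardinal.mk Γ := by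
  have hpair : IsEquilateralWith ({0, 1} : Set C((γ : Γ) → X γ, ℝ))
      (dist (0 : C((γ : Γ) → X γ, ℝ)) 1) := by
    rintro x (rfl | rfl) y (rfl | rfl) hxy
    · exact absurd rfl hxy
    · rfl
    · exact dist_comm _ _
    · exact absurd rfl hxy
  obtain ⟨T, -, hT⟩ := hpair.exists_isMaximalEquilateral (Set.nontrivial_pair zero_ne_one)
  refine le_antisymm ?_ ?_
  · have hle : mNum C((γ : Γ) → X γ, ℝ) ≤ Cardinal.mk T := csInf_le' ⟨T, hT, rfl⟩
    exact hle.trans (hT.1.mk_le X)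
  · refine le_csInf ⟨_, T, hT, rfl⟩ ?_
    rintro _ ⟨S, hS, rfl⟩
    exact hS.le_mk X
end

section
/- Let T = ⋃_{n=0}^∞ {0,1}ⁿ be the dyadic tree ordered by 's ≤ t iff s is an initial segment of t', and let A = {s₁, s₂, …, s_n, …} be an infinite antichain of T (a set of pairwise incomparable elements). For each n set A_n = {k ≤ |s_n| : s_n(k) = 1} and B_n = {k ≤ |s_n| : s_n(k) = 0}, where |s| denotes the length of s. Then the family 𝓕(A) = {(A_n, B_n) : n ∈ ℕ} is a linked family of finite pairs of ℕ. -/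
/-- Two incomparable `0-1` sequences take different values at some common coordinate. -/
theorem exists_getElem?_eq_not_of_incomparable (l m : List Bool)
    (hlm : ¬ l <+: m) (hml : ¬ m <+: l) :
    ∃ (k : ℕ) (b : Bool), l[k]? = some b ∧ m[k]? = some (!b) := by
  induction l generalizing m with
  | nil => exact absurd List.nil_prefix hlm
  | cons a l ih =>
    cases m with
    | nil => exact absurd List.nil_prefix hml
    | cons c m =>
      by_cases hac : a = c
      · subst hac
        obtain ⟨k, b, hl, hm⟩ := ih m (by simpa [List.cons_prefix_cons] using hlm)
          (by simpa [List.cons_prefix_cons] using hml)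
        exact ⟨k + 1, b, by simpa using hl, by simpa using hm⟩
      · exact ⟨0, a, by simp, by cases a <;> cases c <;> simp_all⟩

/-- A list takes a given value at only finitely many coordinates. -/
theorem finite_setOf_getElem?_eq_some {α : Type*} (l : List α) (a : α) :
    {k : ℕ | l[k]? = some a}.Finite :=
  (Set.finite_lt_nat l.length).subset fun _ hk => (List.getElem?_eq_some_iff.mp hk).1

/-- Lemma 6: let `s₁, s₂, …` be an infinite antichain in the dyadic tree of finite `0-1`
sequences (ordered by initial segments), and for each `n` let `A n` (resp. `B n`) be the set
of coordinates where `s n` takes the value `1` (resp. `0`).  Then `{(A n, B n) : n ∈ ℕ}` is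
a linked family of finite pairs of `ℕ`. -/
theorem stmt15 (s : ℕ → List Bool)
    (hanti : ∀ n m, n ≠ m → ¬ (s n <+: s m) ∧ ¬ (s m <+: s n)) :
    IsLinked (fun n => {k : ℕ | (s n)[k]? = some true})
      (fun n => {k : ℕ | (s n)[k]? = some false}) ∧
    ∀ n, {k : ℕ | (s n)[k]? = some true}.Finite ∧
      {k : ℕ | (s n)[k]? = some false}.Finite := by
  refine ⟨⟨fun i => ?_, fun i => ?_, fun i j hij => ?_⟩, fun n =>
    ⟨finite_setOf_getElem?_eq_some _ _, finite_setOf_getElem?_eq_some _ _⟩⟩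
  · ext k
    simp only [Set.mem_inter_iff, Set.mem_ofPred_eq, Set.mem_empty_iff_false, iff_false]
    rintro ⟨h₁, h₂⟩
    simp [h₁] at h₂
  · obtain ⟨h₁, h₂⟩ := hanti i (i + 1) (by omega)
    obtain ⟨k, b, hk, -⟩ := exists_getElem?_eq_not_of_incomparable _ _ h₁ h₂
    cases b
    · exact ⟨k, Or.inr hk⟩
    · exact ⟨k, Or.inl hk⟩
  · obtain ⟨h₁, h₂⟩ := hanti i j hij
    obtain ⟨k, b, hi, hj⟩ := exists_getElem?_eq_not_of_incomparable _ _ h₁ h₂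
    cases b
    · exact Or.inr ⟨k, hj, hi⟩
    · exact Or.inl ⟨k, hi, hj⟩
end

section
/- Let σ = (σ₁, σ₂, …) ∈ {0,1}^ℕ, let φ(0)=1 and φ(1)=0, and let (t_n) be any sequence in the open interval (0,1). Define, for each n ≥ 1, p_n = (σ₁, …, σ_{n−1}, φ(σ_n), t_n, t_n, …) ∈ ℓ_∞ (i.e., p_n(k) = σ_k for k < n, p_n(n) = φ(σ_n), and p_n(k) = t_n for k > n), and let p_ω = σ. Then S ∪ {p_ω}, where S = {p_n : n ≥ 1}, is a maximal 1-equilateral subset of ℓ_∞. More exactly: (a) if σ is eventually constant then S ∪ {p_ω} is a maximal equilateral subset of the space c of convergent sequences, and (b) if σ is not eventually constant then S is a maximal equilateral subset of c. -/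
open scoped ENNReal

instance : Fact ((1 : ℝ≥0∞) ≤ ∞) := ⟨le_top⟩

/-- The Banach space `ℓ∞` of bounded real sequences with the supremum norm. -/
abbrev ellInfty : Type := ↥(lp (fun _ : ℕ => ℝ) ∞)

/-- `c`, the subspace of `ℓ∞` consisting of the convergent sequences. -/
def convSeq : Set ellInfty :=
  {x | ∃ l : ℝ, Filter.Tendsto (⇑x) Filter.atTop (nhds l)}

/-- `boolToReal b` is `1` if `b = 1` and `0` if `b = 0`. -/
noncomputable def boolToReal (b : Bool) : ℝ := if b then 1 else 0

/-- The sequence `p n = (σ 0, …, σ (n-1), φ (σ n), t n, t n, …)`, where `φ` flips a bit. -/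
noncomputable def pFun (σ : ℕ → Bool) (t : ℕ → ℝ) (n : ℕ) : ℕ → ℝ := fun k =>
  if k < n then boolToReal (σ k) else if k = n then boolToReal (!(σ n)) else t n

/-- The sequence `p ω = σ`, viewed as a real sequence of `0`s and `1`s. -/
noncomputable def pOmegaFun (σ : ℕ → Bool) : ℕ → ℝ := fun k => boolToReal (σ k)

/-- The subset `S ∪ {p ω}` of `ℓ∞`, where `S = {p n : n ∈ ℕ}`. -/
def pFullSet (σ : ℕ → Bool) (t : ℕ → ℝ) : Set ellInfty :=
  {x | (∃ n, ⇑x = pFun σ t n) ∨ ⇑x = pOmegaFun σ}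

/-- The subset `S = {p n : n ∈ ℕ}` of `ℓ∞`. -/
def pSet (σ : ℕ → Bool) (t : ℕ → ℝ) : Set ellInfty :=
  {x | ∃ n, ⇑x = pFun σ t n}

theorem boolToReal_mem_Icc (b : Bool) : boolToReal b ∈ Set.Icc (0 : ℝ) 1 := by
  cases b <;> simp [boolToReal]

theorem boolToReal_not (b : Bool) : boolToReal (!b) = 1 - boolToReal b := by
  cases b <;> simp [boolToReal]

theorem pFun_of_lt (σ : ℕ → Bool) (t : ℕ → ℝ) {n k : ℕ} (h : k < n) :
    pFun σ t n k = boolToReal (σ k) := by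
  simp [pFun, h]

theorem pFun_self (σ : ℕ → Bool) (t : ℕ → ℝ) (n : ℕ) :
    pFun σ t n n = 1 - boolToReal (σ n) := by
  simp [pFun, boolToReal_not]

theorem pFun_of_gt (σ : ℕ → Bool) (t : ℕ → ℝ) {n k : ℕ} (h : n < k) :
    pFun σ t n k = t n := by
  simp [pFun, h.not_gt, h.ne']

theorem pFun_mem_Icc (σ : ℕ → Bool) {t : ℕ → ℝ} (ht : ∀ n, t n ∈ Set.Ioo (0 : ℝ) 1)
    (n k : ℕ) : pFun σ t n k ∈ Set.Icc (0 : ℝ) 1 := by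
  unfold pFun
  split_ifs
  · exact boolToReal_mem_Icc _
  · exact boolToReal_mem_Icc _
  · exact Set.Ioo_subset_Icc_self (ht n)

theorem memℓp_of_mem_Icc {f : ℕ → ℝ} (hf : ∀ k, f k ∈ Set.Icc (0 : ℝ) 1) :
    Memℓp (E := fun _ : ℕ => ℝ) f ∞ := by
  refine memℓp_infty ⟨1, ?_⟩
  rintro _ ⟨k, rfl⟩
  refine abs_le.2 ?_
  exact ⟨by linarith [(hf k).1], (hf k).2⟩

theorem exists_coe_eq_pFun (σ : ℕ → Bool) {t : ℕ → ℝ}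
    (ht : ∀ n, t n ∈ Set.Ioo (0 : ℝ) 1) (n : ℕ) : ∃ x : ellInfty, ⇑x = pFun σ t n :=
  ⟨⟨pFun σ t n, memℓp_of_mem_Icc (pFun_mem_Icc σ ht n)⟩, rfl⟩

theorem abs_sub_le_dist (x y : ellInfty) (k : ℕ) : |x k - y k| ≤ dist x y := by
  have h := lp.norm_apply_le_norm (p := ∞) (by simp) (x - y) k
  rwa [← dist_eq_norm] at h

theorem dist_le_of_forall_abs_sub_le {x y : ellInfty} {C : ℝ}
    (h : ∀ k, |x k - y k| ≤ C) : dist x y ≤ C := by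
  rw [dist_eq_norm]
  exact lp.norm_le_of_forall_le ((abs_nonneg _).trans (h 0)) h

theorem dist_eq_one_of_mem_Icc {x y : ellInfty} (hx : ∀ k, x k ∈ Set.Icc (0 : ℝ) 1)
    (hy : ∀ k, y k ∈ Set.Icc (0 : ℝ) 1) {n : ℕ} (h : |x n - y n| = 1) : dist x y = 1 := by
  refine le_antisymm (dist_le_of_forall_abs_sub_le fun k => ?_) (h ▸ abs_sub_le_dist x y n)
  rw [abs_le]
  constructor <;> linarith [(hx k).1, (hx k).2, (hy k).1, (hy k).2]

theorem abs_one_sub_boolToReal_sub (b : Bool) :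
    |1 - boolToReal b - boolToReal b| = 1 := by
  cases b <;> simp [boolToReal]

theorem dist_of_coe_eq_pFun_of_lt {σ : ℕ → Bool} {t : ℕ → ℝ}
    (ht : ∀ n, t n ∈ Set.Ioo (0 : ℝ) 1) {x y : ellInfty} {m n : ℕ} (hmn : m < n)
    (hx : ⇑x = pFun σ t m) (hy : ⇑y = pFun σ t n) : dist x y = 1 := by
  refine dist_eq_one_of_mem_Icc (n := m) ?_ ?_ ?_
  · rw [hx]; exact pFun_mem_Icc σ ht m
  · rw [hy]; exact pFun_mem_Icc σ ht n
  · rw [hx, hy, pFun_self, pFun_of_lt σ t hmn, abs_one_sub_boolToReal_sub]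

theorem dist_of_coe_eq_pFun_pOmegaFun {σ : ℕ → Bool} {t : ℕ → ℝ}
    (ht : ∀ n, t n ∈ Set.Ioo (0 : ℝ) 1) {x y : ellInfty} {n : ℕ}
    (hx : ⇑x = pFun σ t n) (hy : ⇑y = pOmegaFun σ) : dist x y = 1 := by
  refine dist_eq_one_of_mem_Icc (n := n) ?_ ?_ ?_
  · rw [hx]; exact pFun_mem_Icc σ ht n
  · rw [hy]; exact fun k => boolToReal_mem_Icc (σ k)
  · rw [hx, hy, pFun_self, pOmegaFun, abs_one_sub_boolToReal_sub]

theorem isEquilateralWith_pFullSet (σ : ℕ → Bool) {t : ℕ → ℝ}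
    (ht : ∀ n, t n ∈ Set.Ioo (0 : ℝ) 1) : IsEquilateralWith (pFullSet σ t) 1 := by
  rintro x (⟨m, hx⟩ | hx) y (⟨n, hy⟩ | hy) hxy
  · rcases lt_trichotomy m n with h | rfl | h
    · exact dist_of_coe_eq_pFun_of_lt ht h hx hy
    · exact absurd (lp.ext (hx.trans hy.symm)) hxy
    · rw [dist_comm]
      exact dist_of_coe_eq_pFun_of_lt ht h hy hx
  · exact dist_of_coe_eq_pFun_pOmegaFun ht hx hy
  · rw [dist_comm]
    exact dist_of_coe_eq_pFun_pOmegaFun ht hy hx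
  · exact absurd (lp.ext (hx.trans hy.symm)) hxy

/-- The point `p ω` is the only point at distance `1` from all the points `p n`. -/
theorem coe_eq_pOmegaFun_of_dist_eq_one {σ : ℕ → Bool} {t : ℕ → ℝ}
    (ht : ∀ n, t n ∈ Set.Ioo (0 : ℝ) 1) {x : ellInfty}
    (hx : ∀ (n : ℕ) (y : ellInfty), ⇑y = pFun σ t n → dist x y = 1) :
    ⇑x = pOmegaFun σ := by
  have hcoord (n k : ℕ) : |x k - pFun σ t n k| ≤ 1 := by
    obtain ⟨y, hy⟩ := exists_coe_eq_pFun σ ht n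
    rw [← hx n y hy, ← hy]
    exact abs_sub_le_dist x y k
  have hIcc (k : ℕ) : x k ∈ Set.Icc (0 : ℝ) 1 := by
    have h₁ := hcoord k k
    have h₂ := hcoord (k + 1) k
    rw [pFun_self] at h₁
    rw [pFun_of_lt σ t k.lt_succ_self] at h₂
    rw [abs_le] at h₁ h₂
    cases hσ : σ k <;> simp only [hσ, boolToReal] at h₁ h₂ <;> norm_num at h₁ h₂ <;>
      constructor <;> linarith
  funext n
  induction n using Nat.strong_induction_on with
  | _ n ih =>
    obtain ⟨y, hy⟩ := exists_coe_eq_pFun σ ht n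
    obtain ⟨ht₀, ht₁⟩ := ht n
    by_contra hne
    have hn : |x n - (1 - boolToReal (σ n))| < 1 := by
      have hb : x n ≠ boolToReal (σ n) := hne
      obtain ⟨h₀, h₁⟩ := hIcc n
      rw [abs_lt]
      cases hσ : σ n <;> simp only [hσ, boolToReal] at hb ⊢ <;> norm_num at hb ⊢
      · exact ⟨lt_of_le_of_ne h₀ (Ne.symm hb), by linarith⟩
      · exact ⟨by linarith, lt_of_le_of_ne h₁ hb⟩
    have hle : dist x y ≤ max (|x n - (1 - boolToReal (σ n))|) (max (t n) (1 - t n)) := by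
      refine dist_le_of_forall_abs_sub_le fun k => ?_
      rw [hy]
      rcases lt_trichotomy k n with h | rfl | h
      · rw [pFun_of_lt σ t h, ih k h, pOmegaFun, sub_self, abs_zero]
        exact (abs_nonneg _).trans (le_max_left _ _)
      · rw [pFun_self]
        exact le_max_left _ _
      · rw [pFun_of_gt σ t h]
        refine le_trans (abs_le.2 ⟨?_, ?_⟩) (le_max_right _ _)
        · linarith [(hIcc k).1, le_max_left (t n) (1 - t n)]
        · linarith [(hIcc k).2, le_max_right (t n) (1 - t n)]
    rw [hx n y hy] at hle
    exact absurd hle (not_le.2 (max_lt hn (max_lt ht₁ (by linarith))))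

/-- If `M` is isometrically embedded in `ℓ∞` with all the points `p n` in its image, then the
preimage of `S ∪ {p ω}` is a maximal equilateral subset of `M`. -/
theorem isMaximalEquilateral_preimage_pFullSet {M : Type*} [MetricSpace M]
    {f : M → ellInfty} (hf : Isometry f) {σ : ℕ → Bool} {t : ℕ → ℝ}
    (ht : ∀ n, t n ∈ Set.Ioo (0 : ℝ) 1)
    (hrange : ∀ (n : ℕ) (y : ellInfty), ⇑y = pFun σ t n → y ∈ Set.range f) :
    IsMaximalEquilateral (f ⁻¹' pFullSet σ t) := by
  refine ⟨⟨1, one_pos, fun x hx y hy hxy => ?_⟩, ?_⟩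
  · rw [← hf.dist_eq]
    exact isEquilateralWith_pFullSet σ ht _ hx _ hy (hf.injective.ne hxy)
  rintro T ⟨l, -, hT⟩ hST
  have hmem (n : ℕ) : ∃ u ∈ T, ⇑(f u) = pFun σ t n := by
    obtain ⟨y, hy⟩ := exists_coe_eq_pFun σ ht n
    obtain ⟨u, rfl⟩ := hrange n y hy
    exact ⟨u, hST (Or.inl ⟨n, hy⟩), hy⟩
  have hl : l = 1 := by
    obtain ⟨u, hu, hfu⟩ := hmem 0
    obtain ⟨v, hv, hfv⟩ := hmem 1
    have huv : dist u v = 1 := by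
      rw [← hf.dist_eq]
      exact dist_of_coe_eq_pFun_of_lt ht one_pos hfu hfv
    rw [← huv, hT u hu v hv (dist_pos.1 (huv ▸ one_pos))]
  refine Set.Subset.antisymm (fun x hx => ?_) hST
  by_cases hxS : f x ∈ pSet σ t
  · exact Or.inl hxS
  refine Or.inr (coe_eq_pOmegaFun_of_dist_eq_one ht fun n y hy => ?_)
  obtain ⟨u, hu, hfu⟩ := hmem n
  obtain rfl : f u = y := lp.ext (hfu.trans hy.symm)
  rw [hf.dist_eq, hT x hx u hu, hl]
  rintro rfl
  exact hxS ⟨n, hfu⟩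

theorem mem_convSeq_of_coe_eq_pFun {σ : ℕ → Bool} {t : ℕ → ℝ} {n : ℕ} {x : ellInfty}
    (hx : ⇑x = pFun σ t n) : x ∈ convSeq := by
  refine ⟨t n, tendsto_const_nhds.congr' ?_⟩
  filter_upwards [Filter.eventually_gt_atTop n] with k hk
  rw [hx, pFun_of_gt σ t hk]

theorem isMaximalEquilateral_convSeq_pFullSet (σ : ℕ → Bool) {t : ℕ → ℝ}
    (ht : ∀ n, t n ∈ Set.Ioo (0 : ℝ) 1) :
    IsMaximalEquilateral {x : convSeq | (x : ellInfty) ∈ pFullSet σ t} :=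
  isMaximalEquilateral_preimage_pFullSet isometry_subtype_coe ht fun _ y hy =>
    ⟨⟨y, mem_convSeq_of_coe_eq_pFun hy⟩, rfl⟩

theorem eventually_const_of_tendsto_pOmegaFun {σ : ℕ → Bool} {l : ℝ}
    (h : Filter.Tendsto (pOmegaFun σ) Filter.atTop (nhds l)) :
    ∃ (N : ℕ) (b : Bool), ∀ n, N ≤ n → σ n = b := by
  obtain ⟨N, hN⟩ := Metric.cauchySeq_iff'.1 h.cauchySeq 1 one_pos
  refine ⟨N, σ N, fun n hn => ?_⟩
  have hd := hN n hn
  cases hσ : σ n <;> cases hσ' : σ N <;>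
    simp [pOmegaFun, boolToReal, hσ, hσ'] at hd ⊢

/-- Lemma 7: let `σ ∈ {0,1}^ℕ`, let `(t n)` be a sequence in `(0,1)` and let
`p n = (σ 0, …, σ (n-1), φ(σ n), t n, t n, …)`, `p ω = σ`, `S = {p n : n ∈ ℕ}`.  Then
`S ∪ {p ω}` is a maximal `1`-equilateral subset of `ℓ∞`.  More exactly: (a) if `σ` is
eventually constant then `S ∪ {p ω}` is a maximal equilateral subset of the space `c` of
convergent sequences, and (b) if `σ` is not eventually constant then `S` is a maximal
equilateral subset of `c`. -/
theorem stmt16 (σ : ℕ → Bool) (t : ℕ → ℝ) (ht : ∀ n, t n ∈ Set.Ioo (0 : ℝ) 1) :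
    (IsEquilateralWith (pFullSet σ t) 1 ∧ IsMaximalEquilateral (pFullSet σ t)) ∧
    ((∃ (N : ℕ) (b : Bool), ∀ n, N ≤ n → σ n = b) →
      IsMaximalEquilateral {x : convSeq | (x : ellInfty) ∈ pFullSet σ t}) ∧
    ((¬ ∃ (N : ℕ) (b : Bool), ∀ n, N ≤ n → σ n = b) →
      IsMaximalEquilateral {x : convSeq | (x : ellInfty) ∈ pSet σ t}) := by
  refine ⟨⟨isEquilateralWith_pFullSet σ ht,
    isMaximalEquilateral_preimage_pFullSet isometry_id ht fun _ y _ => ⟨y, rfl⟩⟩,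
    fun _ => isMaximalEquilateral_convSeq_pFullSet σ ht, fun hσ => ?_⟩
  convert isMaximalEquilateral_convSeq_pFullSet σ ht using 1
  ext x
  refine ⟨Or.inl, ?_⟩
  rintro (hx | hx)
  · exact hx
  · obtain ⟨l, hl⟩ := x.2
    exact absurd (eventually_const_of_tendsto_pOmegaFun (hx ▸ hl)) hσ
end

section
/- Let Γ be an infinite set and let K be a compact Hausdorff space containing an infinite set of isolated points having a unique limit point. Then m(ℓ_∞(Γ)) = ℵ₀ and m(C(K)) = ℵ₀, where ℓ_∞(Γ) is the Banach space of bounded real-valued functions on Γ with the supremum norm; that is, each of these spaces contains a countably infinite maximal equilateral set, and no maximal equilateral set in them is finite. -/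
open scoped ENNReal

open Filter Topology

lemma IsEquilateral.image {M N : Type*} [MetricSpace M] [MetricSpace N] (e : M ≃ᵢ N)
    {S : Set M} (hS : IsEquilateral S) : IsEquilateral (e '' S) := by
  obtain ⟨l, hl, h⟩ := hS
  refine ⟨l, hl, ?_⟩
  rintro _ ⟨x, hx, rfl⟩ _ ⟨y, hy, rfl⟩ hxy
  rw [e.dist_eq]
  exact h x hx y hy fun h => hxy (h ▸ rfl)

lemma IsMaximalEquilateral.image {M N : Type*} [MetricSpace M] [MetricSpace N] (e : M ≃ᵢ N)
    {S : Set M} (hS : IsMaximalEquilateral S) : IsMaximalEquilateral (e '' S) := by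
  refine ⟨hS.1.image e, fun T hT hST => ?_⟩
  have h := hS.2 _ (hT.image e.symm) fun x hx => ⟨e x, hST ⟨x, hx, rfl⟩, e.symm_apply_apply x⟩
  rw [← h, Set.image_image]
  simp

/-- In `C(X, ℝ)`, with `X` infinite compact Hausdorff, every finite equilateral set extends. -/
lemma not_isMaximalEquilateral_of_finite {X : Type*} [TopologicalSpace X] [CompactSpace X]
    [T2Space X] [Infinite X] {S : Set C(X, ℝ)} (hfin : S.Finite) :
    ¬ IsMaximalEquilateral S := by
  rintro ⟨⟨l, hl, hS⟩, hmax⟩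
  rcases S.eq_empty_or_nonempty with rfl | hne
  · have h := hmax {0} ⟨1, one_pos, by
      rintro x rfl y rfl h
      exact absurd rfl h⟩ (Set.empty_subset _)
    exact Set.singleton_ne_empty _ h
  have hSle : ∀ x ∈ S, ∀ y ∈ S, ∀ t, |x t - y t| ≤ l := by
    intro x hx y hy t
    by_cases hxy : x = y
    · simp [hxy, hl.le]
    · rw [← hS x hx y hy hxy, ← Real.dist_eq]
      exact ContinuousMap.dist_apply_le_dist t
  have hatt : ∀ x : C(X, ℝ), ∀ y : C(X, ℝ), ∃ t, x ∈ S → y ∈ S → x ≠ y → |x t - y t| = l := by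
    intro x y
    by_cases h : x ∈ S ∧ y ∈ S ∧ x ≠ y
    · obtain ⟨hx, hy, hxy⟩ := h
      by_contra! hcon
      have : dist x y < l := (ContinuousMap.dist_lt_iff hl).2 fun t =>
        (Real.dist_eq _ _).trans_lt (lt_of_le_of_ne (hSle x hx y hy t) (hcon t).2.2.2)
      exact this.ne (hS x hx y hy hxy)
    · exact ⟨Classical.arbitrary X, fun hx hy hxy => absurd ⟨hx, hy, hxy⟩ h⟩
  choose τ hτ using hatt
  set F : Set X := (fun p : C(X, ℝ) × C(X, ℝ) => τ p.1 p.2) '' (S ×ˢ S)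
  have hFfin : F.Finite := (hfin.prod hfin).image _
  obtain ⟨t₀, ht₀⟩ := hFfin.exists_notMem
  obtain ⟨x₀, hx₀, hx₀max⟩ := hfin.exists_maximalFor (fun x : C(X, ℝ) => x t₀) S hne
  replace hx₀max : ∀ y ∈ S, y t₀ ≤ x₀ t₀ := fun y hy => by
    rcases le_total (y t₀) (x₀ t₀) with h | h
    · exact h
    · exact hx₀max hy h
  obtain ⟨h, hhF, hht, hh01⟩ := exists_continuous_zero_one_of_isClosed hFfin.isClosed
    (isClosed_singleton (x := t₀)) (Set.disjoint_singleton_right.2 ht₀)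
  have hne' : hfin.toFinset.Nonempty := by simpa using hne
  set m : C(X, ℝ) := hfin.toFinset.sup' hne' id with hm
  have hmle : ∀ y ∈ S, ∀ t, y t ≤ m t := by
    intro y hy t
    rw [hm, ContinuousMap.sup'_apply]
    exact Finset.le_sup' (fun i : C(X, ℝ) => (id i) t) (by simpa using hy)
  have hmex : ∀ t, ∃ y ∈ S, m t = y t := by
    intro t
    obtain ⟨y, hy, h⟩ := Finset.exists_mem_eq_sup' hne' (fun i : C(X, ℝ) => (id i) t)
    exact ⟨y, by simpa using hy, by rw [hm, ContinuousMap.sup'_apply, h]; rfl⟩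
  set f : C(X, ℝ) := ⟨fun t => max (m t - l) (x₀ t - l * h t), by fun_prop⟩
  have hfval : ∀ t, f t = max (m t - l) (x₀ t - l * h t) := fun t => rfl
  have hfle : ∀ y ∈ S, ∀ t, |f t - y t| ≤ l := by
    intro y hy t
    obtain ⟨z, hz, hzt⟩ := hmex t
    have h1 := abs_le.1 (hSle z hz y hy t)
    have h2 := abs_le.1 (hSle x₀ hx₀ y hy t)
    have h3 := hmle y hy t
    have h4 : 0 ≤ l * h t := mul_nonneg hl.le (hh01 t).1
    rw [hfval, abs_le]
    constructor
    · linarith [le_max_left (m t - l) (x₀ t - l * h t)]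
    · have : max (m t - l) (x₀ t - l * h t) ≤ l + y t := max_le (by linarith) (by linarith)
      linarith
  have hfatt : ∀ y ∈ S, ∃ t, |f t - y t| = l := by
    intro y hy
    by_cases hxy : x₀ = y
    · subst hxy
      refine ⟨t₀, ?_⟩
      obtain ⟨z, hz, hzt⟩ := hmex t₀
      have h1 : m t₀ = x₀ t₀ := le_antisymm (hzt ▸ hx₀max z hz) (hmle _ hx₀ _)
      have h2 : h t₀ = 1 := hht rfl
      rw [hfval, h1, h2, mul_one, max_self, sub_sub_cancel_left, abs_neg, abs_of_pos hl]
    · refine ⟨τ x₀ y, ?_⟩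
      have h2 : h (τ x₀ y) = 0 := hhF ⟨(x₀, y), ⟨hx₀, hy⟩, rfl⟩
      obtain ⟨z, hz, hzt⟩ := hmex (τ x₀ y)
      have h1 := abs_le.1 (hSle z hz x₀ hx₀ (τ x₀ y))
      rw [hfval, h2, mul_zero, sub_zero, max_eq_right (by linarith)]
      exact hτ x₀ y hx₀ hy hxy
  have hfdist : ∀ y ∈ S, dist f y = l := by
    intro y hy
    apply le_antisymm
    · exact (ContinuousMap.dist_le hl.le).2 fun t => (Real.dist_eq _ _).trans_le (hfle y hy t)
    · obtain ⟨t, ht⟩ := hfatt y hy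
      rw [← ht, ← Real.dist_eq]
      exact ContinuousMap.dist_apply_le_dist t
  have hfS : f ∉ S := fun hfS => by
    have := hfdist f hfS
    rw [dist_self] at this
    exact hl.ne this
  have hT := hmax (insert f S) ⟨l, hl, by
    rintro x (rfl | hx) y (rfl | hy) hxy
    · exact absurd rfl hxy
    · exact hfdist y hy
    · rw [dist_comm]; exact hfdist x hx
    · exact hS x hx y hy hxy⟩ (Set.subset_insert _ _)
  exact hfS (hT ▸ Set.mem_insert f S)

/-- The sequence alternating between `1 / 2` and `-1 / 2`. -/
noncomputable def altHalf (n : ℕ) : ℝ := (-1) ^ n / 2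

lemma abs_altHalf (n : ℕ) : |altHalf n| = 1 / 2 := by
  rcases neg_one_pow_eq_or ℝ n with h | h <;> norm_num [altHalf, h, abs_div]

/-- A sequence in `(-1 / 2, 1 / 2)` with cluster points `1 / 2` and `-1 / 2`. -/
noncomputable def innerAlt (n : ℕ) : ℝ := altHalf n * (1 - 1 / (n + 1))

lemma abs_innerAlt_lt (n : ℕ) : |innerAlt n| < 1 / 2 := by
  have h1 : (0 : ℝ) < 1 / (n + 1) := by positivity
  have h2 : (1 : ℝ) / (n + 1) ≤ 1 := by
    rw [div_le_one (by positivity)]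
    linarith [(Nat.cast_nonneg n : (0 : ℝ) ≤ n)]
  rw [innerAlt, abs_mul, abs_altHalf, abs_of_nonneg (by linarith)]
  linarith

/-- A function agreeing with the alternating sequence along `d` before index `i`, taking the
opposite value at index `i`, and constant elsewhere. -/
noncomputable def flipFun {X : Type*} (d : ℕ → X) (i : ℕ) : X → ℝ :=
  Function.extend d
    (fun j => if j < i then altHalf j else if j = i then -altHalf i else innerAlt i)
    (fun _ => innerAlt i)

section flipFun

variable {X : Type*} {d : ℕ → X}

lemma flipFun_of_lt (hd : d.Injective) {i j : ℕ} (h : j < i) :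
    flipFun d i (d j) = altHalf j := by
  simp [flipFun, hd.extend_apply, h]

lemma flipFun_self (hd : d.Injective) (i : ℕ) : flipFun d i (d i) = -altHalf i := by
  simp [flipFun, hd.extend_apply]

lemma flipFun_of_forall_ne (hd : d.Injective) {i : ℕ} {t : X} (h : ∀ j ≤ i, d j ≠ t) :
    flipFun d i t = innerAlt i := by
  by_cases ht : ∃ j, d j = t
  · obtain ⟨j, rfl⟩ := ht
    have hj : i < j := by
      by_contra! hj
      exact h j hj rfl
    simp [flipFun, hd.extend_apply, hj.not_gt, hj.ne']
  · simp [flipFun, Function.extend_apply' _ _ _ ht]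

lemma abs_flipFun_le (hd : d.Injective) (i : ℕ) (t : X) : |flipFun d i t| ≤ 1 / 2 := by
  by_cases h : ∀ j ≤ i, d j ≠ t
  · rw [flipFun_of_forall_ne hd h]
    exact (abs_innerAlt_lt i).le
  · push Not at h
    obtain ⟨j, hj, rfl⟩ := h
    rcases hj.lt_or_eq with hj | rfl
    · rw [flipFun_of_lt hd hj, abs_altHalf]
    · rw [flipFun_self hd, abs_neg, abs_altHalf]

lemma continuous_flipFun [TopologicalSpace X] [T1Space X] (hd : d.Injective)
    (hopen : ∀ n, IsOpen ({d n} : Set X)) (i : ℕ) : Continuous (flipFun d i) := by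
  rw [continuous_iff_continuousAt]
  intro t
  by_cases h : ∀ j ≤ i, d j ≠ t
  · have hfin : (d '' Set.Iic i).Finite := (Set.finite_Iic i).image d
    have hmem : (d '' Set.Iic i)ᶜ ∈ 𝓝 t := hfin.isClosed.isOpen_compl.mem_nhds <| by
      rintro ⟨j, hj, hjt⟩
      exact h j hj hjt
    have heq : flipFun d i =ᶠ[𝓝 t] fun _ => innerAlt i := by
      filter_upwards [hmem] with s hs
      exact flipFun_of_forall_ne hd fun j hj hjs => hs ⟨j, hj, hjs⟩
    exact continuousAt_const.congr heq.symm
  · push Not at h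
    obtain ⟨j, -, rfl⟩ := h
    rw [ContinuousAt, (isOpen_singleton_iff_nhds_eq_pure _).1 (hopen j)]
    exact tendsto_pure_nhds _ _

end flipFun

lemma abs_le_half_of_flipFun {X : Type*} {d : ℕ → X} (hd : d.Injective) {f : X → ℝ}
    (hf : ∀ i t, |f t - flipFun d i t| ≤ 1) (t : X) : |f t| ≤ 1 / 2 := by
  by_cases ht : ∃ j, d j = t
  · obtain ⟨j, rfl⟩ := ht
    have h1 := hf j (d j)
    have h2 := hf (j + 1) (d j)
    rw [flipFun_self hd] at h1
    rw [flipFun_of_lt hd (Nat.lt_succ_self j)] at h2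
    rw [abs_le] at h1 h2 ⊢
    rcases neg_one_pow_eq_or ℝ j with h | h <;> simp only [altHalf, h] at h1 h2 <;>
      constructor <;> linarith
  · push Not at ht
    have hc : ∀ i, |f t - innerAlt i| ≤ 1 := fun i => by
      simpa only [flipFun_of_forall_ne hd fun j _ => ht j] using hf i t
    have hlim : Tendsto (fun n : ℕ => (1 : ℝ) / (n + 1)) atTop (𝓝 0) :=
      tendsto_one_div_add_atTop_nhds_zero_nat
    have hpos : Tendsto (fun n : ℕ => innerAlt (2 * n)) atTop (𝓝 (1 / 2)) := by
      have h := (hlim.comp (tendsto_id.const_mul_atTop' (two_pos : 0 < 2))).const_sub 1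
      have h' := h.const_mul (1 / 2)
      simp only [sub_zero, mul_one] at h'
      refine h'.congr fun n => ?_
      simp [innerAlt, altHalf]
    have hneg : Tendsto (fun n : ℕ => innerAlt (2 * n + 1)) atTop (𝓝 (-(1 / 2))) := by
      have h := (hlim.comp ((tendsto_add_atTop_nat 1).comp
        (tendsto_id.const_mul_atTop' (two_pos : 0 < 2)))).const_sub 1
      have h' := h.const_mul (-(1 / 2))
      simp only [sub_zero, mul_one] at h'
      refine h'.congr fun n => ?_
      simp [innerAlt, altHalf, pow_succ]
      ring
    have h1 : |f t - 1 / 2| ≤ 1 :=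
      le_of_tendsto (hpos.const_sub (f t)).abs (Eventually.of_forall fun n => hc _)
    have h2 : |f t - -(1 / 2)| ≤ 1 :=
      le_of_tendsto (hneg.const_sub (f t)).abs (Eventually.of_forall fun n => hc _)
    rw [abs_le] at h1 h2 ⊢
    constructor <;> linarith

/-- Given isolated points `d n` of a compact space, the functions `flipFun d i` together with the
functions in a set `G` form a countable maximal equilateral set as soon as every function bounded
by `1 / 2` and alternating along `d` is near an element of `G` of the same kind. -/
lemma exists_countable_isMaximalEquilateral {X : Type*} [TopologicalSpace X] [CompactSpace X]
    [T2Space X] {d : ℕ → X} (hd : d.Injective) (hopen : ∀ n, IsOpen ({d n} : Set X))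
    {G : Set C(X, ℝ)} (hG : G.Subsingleton) (hGd : ∀ g ∈ G, ∀ n, g (d n) = altHalf n)
    (hGle : ∀ g ∈ G, ∀ t, |g t| ≤ 1 / 2)
    (hnear : ∀ f : C(X, ℝ), (∀ t, |f t| ≤ 1 / 2) → (∀ n, f (d n) = altHalf n) →
      ∃ g ∈ G, dist f g < 1) :
    ∃ S : Set C(X, ℝ), IsMaximalEquilateral S ∧ Cardinal.mk S = Cardinal.aleph0 := by
  set x : ℕ → C(X, ℝ) := fun i => ⟨flipFun d i, continuous_flipFun hd hopen i⟩
  have hxv : ∀ i t, x i t = flipFun d i t := fun i t => rfl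
  have dist_eq : ∀ (u : C(X, ℝ)) (i : ℕ), (∀ t, |u t| ≤ 1 / 2) → u (d i) = altHalf i →
      dist u (x i) = 1 := by
    intro u i hu hui
    apply le_antisymm
    · refine (ContinuousMap.dist_le zero_le_one).2 fun t => ?_
      have h1 := abs_le.1 (hu t)
      have h2 := abs_le.1 (abs_flipFun_le hd i t)
      rw [Real.dist_eq, hxv, abs_le]
      constructor <;> linarith
    · have h := ContinuousMap.dist_apply_le_dist (f := u) (g := x i) (d i)
      have h' := abs_altHalf i
      rw [Real.dist_eq, hui, hxv, flipFun_self hd, sub_neg_eq_add, ← two_mul, abs_mul, h',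
        abs_two] at h
      linarith
  have hxx : ∀ i j, i ≠ j → dist (x i) (x j) = 1 := by
    intro i j hij
    rcases lt_or_gt_of_ne hij with h | h
    · rw [dist_comm]
      exact dist_eq _ _ (abs_flipFun_le hd j) (flipFun_of_lt hd h)
    · exact dist_eq _ _ (abs_flipFun_le hd i) (flipFun_of_lt hd h)
  have hxinj : x.Injective := by
    intro i j hij
    by_contra h
    have := hxx i j h
    rw [hij, dist_self] at this
    exact zero_ne_one this
  refine ⟨Set.range x ∪ G, ⟨⟨1, one_pos, ?_⟩, ?_⟩, ?_⟩
  · rintro u (⟨i, rfl⟩ | hu) v (⟨j, rfl⟩ | hv) huv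
    · exact hxx i j fun h => huv (h ▸ rfl)
    · rw [dist_comm]
      exact dist_eq v i (hGle v hv) (hGd v hv i)
    · exact dist_eq u j (hGle u hu) (hGd u hu j)
    · exact absurd (hG hu hv) huv
  · rintro T ⟨l, hl, hT⟩ hST
    have hxT : ∀ i, x i ∈ T := fun i => hST (Or.inl ⟨i, rfl⟩)
    have hl1 : l = 1 := by
      rw [← hT _ (hxT 0) _ (hxT 1) (hxinj.ne zero_ne_one), hxx 0 1 zero_ne_one]
    subst hl1
    refine Set.Subset.antisymm (fun f hf => ?_) hST
    by_contra hfS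
    have hdist : ∀ y ∈ Set.range x ∪ G, dist f y = 1 := fun y hy =>
      hT f hf y (hST hy) fun h => hfS (h ▸ hy)
    have hfx : ∀ i t, |f t - flipFun d i t| ≤ 1 := fun i t => by
      rw [← hdist (x i) (Or.inl ⟨i, rfl⟩), ← hxv, ← Real.dist_eq]
      exact ContinuousMap.dist_apply_le_dist t
    have hfle := abs_le_half_of_flipFun hd hfx
    have hfd : ∀ n, f (d n) = altHalf n := by
      intro n
      induction n using Nat.strong_induction_on with
      | _ n ih =>
        by_contra hne
        refine (hdist (x n) (Or.inl ⟨n, rfl⟩)).not_lt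
          ((ContinuousMap.dist_lt_iff one_pos).2 fun t => ?_)
        rw [Real.dist_eq, hxv]
        by_cases h : ∀ j ≤ n, d j ≠ t
        · rw [flipFun_of_forall_ne hd h]
          have h1 := abs_le.1 (hfle t)
          have h2 := abs_lt.1 (abs_innerAlt_lt n)
          rw [abs_lt]
          constructor <;> linarith
        · push Not at h
          obtain ⟨j, hj, rfl⟩ := h
          rcases hj.lt_or_eq with hj | rfl
          · rw [ih j hj, flipFun_of_lt hd hj, sub_self, abs_zero]
            exact one_pos
          · rw [flipFun_self hd]
            have h1 := abs_le.1 (hfle (d j))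
            rw [abs_lt]
            rcases neg_one_pow_eq_or ℝ j with h | h <;> simp only [altHalf, h] at hne ⊢
            · have := lt_of_le_of_ne h1.2 hne
              constructor <;> linarith
            · have := lt_of_le_of_ne h1.1 fun h => hne (by rw [← h]; norm_num)
              constructor <;> linarith
    obtain ⟨g, hg, hfg⟩ := hnear f hfle hfd
    exact hfg.ne (hdist g (Or.inr hg))
  · have hc : (Set.range x ∪ G).Countable := (Set.countable_range x).union hG.finite.countable
    have hi : (Set.range x ∪ G).Infinite :=
      (Set.infinite_range_of_injective hxinj).mono Set.subset_union_left
    have := hc.to_subtype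
    have := hi.to_subtype
    exact Cardinal.mk_eq_aleph0 _

lemma mNum_eq_aleph0 {M : Type*} [MetricSpace M]
    (hfin : ∀ S : Set M, S.Finite → ¬ IsMaximalEquilateral S)
    (hex : ∃ S : Set M, IsMaximalEquilateral S ∧ Cardinal.mk S = Cardinal.aleph0) :
    mNum M = Cardinal.aleph0 := by
  apply le_antisymm
  · exact csInf_le' hex
  · refine le_csInf ⟨_, hex⟩ ?_
    rintro c ⟨S, hS, rfl⟩
    by_contra! h
    exact hfin S (Cardinal.lt_aleph0_iff_set_finite.1 h) hS

lemma exists_continuousMap_ultrafilter {Γ : Type*} (h : Γ → ℝ) (C : ℝ) (hC : ∀ a, |h a| ≤ C) :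
    ∃ g : C(Ultrafilter Γ, ℝ), (∀ a, g (pure a) = h a) ∧ ∀ u, |g u| ≤ C := by
  let k : Γ → Set.Icc (-C) C := fun a => ⟨h a, abs_le.1 (hC a)⟩
  refine ⟨⟨fun u => ((Ultrafilter.extend k u : Set.Icc (-C) C) : ℝ),
    continuous_subtype_val.comp (continuous_ultrafilter_extend k)⟩, fun a => ?_, fun u => ?_⟩
  · change ((Ultrafilter.extend k (pure a) : Set.Icc (-C) C) : ℝ) = h a
    rw [ultrafilter_extend_pure]
  · exact abs_le.2 (Ultrafilter.extend k u).2

/-- Restriction to principal ultrafilters identifies `C(Ultrafilter Γ, ℝ)` with `ℓ∞(Γ)`. -/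
lemma nonempty_isometryEquiv_lp (Γ : Type*) :
    Nonempty (C(Ultrafilter Γ, ℝ) ≃ᵢ lp (fun _ : Γ => ℝ) ∞) := by
  let F : C(Ultrafilter Γ, ℝ) → lp (fun _ : Γ => ℝ) ∞ := fun f =>
    ⟨fun a => f (pure a), memℓp_infty ⟨‖f‖, by
      rintro _ ⟨a, rfl⟩
      exact f.norm_coe_le_norm _⟩⟩
  have hFv : ∀ f a, F f a = f (pure a) := fun f a => rfl
  have hF : Isometry F := by
    refine Isometry.of_dist_eq fun f g => le_antisymm ?_ ?_
    · rw [dist_eq_norm]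
      refine lp.norm_le_of_forall_le dist_nonneg fun a => ?_
      rw [lp.coeFn_sub, Pi.sub_apply, hFv, hFv, ← dist_eq_norm]
      exact ContinuousMap.dist_apply_le_dist _
    · refine (ContinuousMap.dist_le dist_nonneg).2 fun u => ?_
      refine denseRange_pure.induction_on (p := fun u => dist (f u) (g u) ≤ dist (F f) (F g)) u
        (isClosed_le (by fun_prop) continuous_const) fun a => ?_
      rw [dist_eq_norm (F f), ← hFv, ← hFv, dist_eq_norm]
      exact lp.norm_apply_le_norm ENNReal.top_ne_zero (F f - F g) a
  have hsurj : F.Surjective := by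
    intro y
    obtain ⟨g, hg, -⟩ := exists_continuousMap_ultrafilter y ‖y‖ fun a =>
      lp.norm_apply_le_norm ENNReal.top_ne_zero y a
    exact ⟨g, lp.ext (funext hg)⟩
  exact ⟨⟨Equiv.ofBijective F ⟨hF.injective, hsurj⟩, hF⟩⟩

lemma isOpen_singleton_pure_ultrafilter {Γ : Type*} (a : Γ) :
    IsOpen ({pure a} : Set (Ultrafilter Γ)) := by
  convert ultrafilter_isOpen_basic ({a} : Set Γ) using 1
  ext u
  simp only [Set.mem_singleton_iff, Set.mem_ofPred_eq]
  constructor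
  · rintro rfl
    exact Set.mem_singleton a
  · intro h
    have h' : (u : Filter Γ) ≤ (pure a : Ultrafilter Γ) := le_pure_iff.2 h
    exact Ultrafilter.coe_le_coe.1 h'

lemma exists_maximal_ultrafilter (Γ : Type*) [Infinite Γ] :
    ∃ S : Set C(Ultrafilter Γ, ℝ), IsMaximalEquilateral S ∧
      Cardinal.mk S = Cardinal.aleph0 := by
  let a : ℕ ↪ Γ := Infinite.natEmbedding Γ
  obtain ⟨g, hg, hgle⟩ := exists_continuousMap_ultrafilter
    (Function.extend a altHalf fun _ => 0) (1 / 2) (fun t => by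
      by_cases ht : ∃ n, a n = t
      · obtain ⟨n, rfl⟩ := ht
        rw [a.injective.extend_apply, abs_altHalf]
      · rw [Function.extend_apply' _ _ _ ht]
        norm_num)
  have hga : ∀ n, g (pure (a n)) = altHalf n := fun n => by
    rw [hg, a.injective.extend_apply]
  refine exists_countable_isMaximalEquilateral (d := fun n => (pure (a n) : Ultrafilter Γ))
    (Ultrafilter.pure_injective.comp a.injective) (fun n => isOpen_singleton_pure_ultrafilter _)
    (G := {g}) Set.subsingleton_singleton ?_ ?_ ?_
  · rintro _ rfl n
    exact hga n
  · rintro _ rfl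
    exact hgle
  · intro f hfle hfd
    refine ⟨g, rfl, lt_of_le_of_lt (b := 1 / 2) ?_ (by norm_num)⟩
    refine (ContinuousMap.dist_le (by norm_num)).2 fun u => ?_
    refine denseRange_pure.induction_on (p := fun u => dist (f u) (g u) ≤ 1 / 2) u
      (isClosed_le (by fun_prop) continuous_const) fun t => ?_
    by_cases ht : ∃ n, a n = t
    · obtain ⟨n, rfl⟩ := ht
      rw [hfd, hga, dist_self]
      norm_num
    · rw [hg, Function.extend_apply' _ _ _ ht, dist_zero_right]
      exact hfle _

/-- If `p` is the only limit point of the set `D` of isolated points, a continuous function that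
takes the value `c` along an injective sequence in `D` takes the value `c` at `p`. -/
lemma eq_of_unique_limit {K : Type*} [TopologicalSpace K] [CompactSpace K]
    {D : Set K} (hisol : ∀ x ∈ D, IsOpen ({x} : Set K)) {p : K}
    (hp : ∀ q ∈ closure D \ D, q = p) {e : ℕ → K} (he : e.Injective) (heD : ∀ n, e n ∈ D)
    {f : K → ℝ} (hf : Continuous f) {c : ℝ} (hc : ∀ n, f (e n) = c) : f p = c := by
  obtain ⟨q, hq⟩ := exists_clusterPt_of_compactSpace (map e atTop)
  have hq' : MapClusterPt q atTop e := hq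
  have hqD : q ∈ closure D :=
    isClosed_closure.mem_of_mapClusterPt hq' (Eventually.of_forall fun n => subset_closure (heD n))
  have hqn : q ∉ D := fun hqD => by
    have h1 : ∃ᶠ n in atTop, e n ∈ ({q} : Set K) :=
      hq'.frequently ((hisol q hqD).mem_nhds rfl)
    obtain ⟨n, hn⟩ := h1.exists
    obtain ⟨m, hm, hm'⟩ := (frequently_atTop.1 h1) (n + 1)
    have : m = n := he (Eq.trans hm' (Eq.symm hn))
    omega
  rw [← hp q ⟨hqD, hqn⟩]
  exact (isClosed_singleton.preimage hf).mem_of_mapClusterPt hq' (Eventually.of_forall hc)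

/-- Theorem 7: let `Γ` be an infinite set and let `K` be a compact Hausdorff space
containing an infinite set `D` of isolated points having a unique limit point.  Then the
minimum cardinality of a maximal equilateral set in `ℓ∞(Γ)` (bounded real functions on `Γ`
with the sup norm), as well as in `C(K)`, is `ℵ₀`. -/
theorem stmt18 {Γ : Type*} [Infinite Γ] {K : Type*} [TopologicalSpace K] [CompactSpace K]
    [T2Space K] (D : Set K) (hD : D.Infinite) (hisol : ∀ x ∈ D, IsOpen ({x} : Set K))
    (hlim : ∃! p : K, p ∈ closure D \ D) :
    mNum (↥(lp (fun _ : Γ => ℝ) ∞)) = Cardinal.aleph0 ∧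
    mNum C(K, ℝ) = Cardinal.aleph0 := by
  constructor
  · obtain ⟨e⟩ := nonempty_isometryEquiv_lp Γ
    have : Infinite (Ultrafilter Γ) := Infinite.of_injective _ Ultrafilter.pure_injective
    refine mNum_eq_aleph0 (fun S hS hmax => ?_) ?_
    · exact not_isMaximalEquilateral_of_finite (hS.image e.symm) (hmax.image e.symm)
    · obtain ⟨S, hS, hcard⟩ := exists_maximal_ultrafilter Γ
      exact ⟨e '' S, hS.image e, (Cardinal.mk_image_eq e.injective).trans hcard⟩
  · have : Infinite K := Set.infinite_univ_iff.1 (hD.mono (Set.subset_univ D))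
    refine mNum_eq_aleph0 (fun S hS => not_isMaximalEquilateral_of_finite hS) ?_
    obtain ⟨p, -, hp⟩ := hlim
    have hd : (fun n => (hD.natEmbedding D n : K)).Injective :=
      Subtype.val_injective.comp (hD.natEmbedding D).injective
    refine exists_countable_isMaximalEquilateral hd
      (fun n => hisol _ (hD.natEmbedding D n).2) (G := ∅) Set.subsingleton_empty
      (by simp) (by simp) fun f _ hfd => ?_
    have heven : f p = 1 / 2 := eq_of_unique_limit hisol hp
      (e := fun n => hD.natEmbedding D (2 * n))
      (fun m n h => by have := hd h; omega) (fun n => (hD.natEmbedding D _).2) f.continuous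
      fun n => by rw [hfd]; simp [altHalf]
    have hodd : f p = -(1 / 2) := eq_of_unique_limit hisol hp
      (e := fun n => hD.natEmbedding D (2 * n + 1))
      (fun m n h => by have := hd h; omega) (fun n => (hD.natEmbedding D _).2) f.continuous
      fun n => by rw [hfd]; simp [altHalf, pow_succ]; norm_num
    norm_num [heven] at hodd
end
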